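/- arXiv:math/0608554 — 11 statements merged into one kernel-verified Lean document; each statement's English description precedes it below -/
import Mathlib

section
/- For every field K, every n-dimensional K-vector space V equipped with a complete flag V_• = (V_1 ⊂ ⋯ ⊂ V_n = V), and every pair of subspaces U, W ⊆ V with dim U = k and dim W = l, there exists an adapted triple of ordered bases of U, W and V. -/
/-- The support (set of indices of basis vectors of `V` involved) of an entry describing a
basis vector of `W`: either a single index `β`, or a pair `(γ, δ)`. -/
def suppOf {n : ℕ} : (Fin n) ⊕ (Fin n × Fin n) → Finset (Fin n)
  | Sum.inl b => {b}
  | Sum.inr p => {p.1, p.2}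

/-- A complete flag `V_0 = 0 ⊂ V_1 ⊂ ⋯ ⊂ V_n = V` with `dim V_i = i`. -/
def IsCompleteFlag (K V : Type*) [Field K] [AddCommGroup V] [Module K V]
    (n : ℕ) (flag : ℕ → Submodule K V) : Prop :=
  flag 0 = ⊥ ∧ flag n = ⊤ ∧ (∀ i, i ≤ n → Module.finrank K (flag i) = i) ∧
    ∀ i j, i ≤ j → j ≤ n → flag i ≤ flag j

/-- An *adapted triple* of ordered bases `(u, w, v)` of `(U, W, V)` with respect to the
complete flag `flag`: `v` spans the flag, each `u i` is a flag basis vector `v (α i)`,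
each `w i` is either a flag basis vector `v β` or a sum `v γ + v δ` with `δ < γ`,
`γ ∈ range α`, all the indices `β, γ, δ` are pairwise distinct, and no `δ` lies in
`range α`. -/
structure AdaptedTriple (K V : Type*) [Field K] [AddCommGroup V] [Module K V]
    (n k l : ℕ) (flag : ℕ → Submodule K V) (U W : Submodule K V) where
  v : Fin n → V
  u : Fin k → V
  w : Fin l → V
  α : Fin k → Fin n
  idx : Fin l → (Fin n) ⊕ (Fin n × Fin n)
  hv_indep : LinearIndependent K v
  hu_indep : LinearIndependent K u
  hw_indep : LinearIndependent K w
  hflag : ∀ m : ℕ, m ≤ n → flag m = Submodule.span K (v '' {j : Fin n | (j : ℕ) < m})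
  hu_span : Submodule.span K (Set.range u) = U
  hw_span : Submodule.span K (Set.range w) = W
  hα : Function.Injective α
  hu : ∀ i, u i = v (α i)
  hw_single : ∀ i b, idx i = Sum.inl b → w i = v b
  hw_pair : ∀ i γ δ, idx i = Sum.inr (γ, δ) →
    w i = v γ + v δ ∧ δ < γ ∧ γ ∈ Set.range α
  hsupp : ∀ i j, i ≠ j → Disjoint (suppOf (idx i)) (suppOf (idx j))
  hδ : ∀ i γ δ, idx i = Sum.inr (γ, δ) → δ ∉ Set.range α

namespace AdaptedTriple

variable {K V : Type*} [Field K] [AddCommGroup V] [Module K V]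
variable {n k l : ℕ} {flag : ℕ → Submodule K V} {U W : Submodule K V}

/-- The set `ᾱ` of the combinatorial data of an adapted triple. -/
def alphaSet (T : AdaptedTriple K V n k l flag U W) : Set (Fin n) := Set.range T.α

/-- The set `β̄` of the combinatorial data of an adapted triple. -/
def betaSet (T : AdaptedTriple K V n k l flag U W) : Set (Fin n) :=
  {b | ∃ i, T.idx i = Sum.inl b}

/-- The set `γ̄` of the combinatorial data of an adapted triple. -/
def gammaSet (T : AdaptedTriple K V n k l flag U W) : Set (Fin n) :=
  {g | ∃ i δ, T.idx i = Sum.inr (g, δ)}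

/-- The involution `σ`, product of the disjoint transpositions `(γ_i, δ_i)`, of the
combinatorial data of an adapted triple (as a function `Fin n → Fin n`). -/
noncomputable def sigmaFun (T : AdaptedTriple K V n k l flag U W) : Fin n → Fin n :=
  fun x =>
    if h : ∃ p : Fin n × Fin n, (∃ i, T.idx i = Sum.inr p) ∧ (x = p.1 ∨ x = p.2) then
      (if x = h.choose.1 then h.choose.2 else h.choose.1)
    else x

end AdaptedTriple

section AdaptedConstruction

variable {K V : Type*} [Field K] [AddCommGroup V] [Module K V]

/-- The vector attached to an entry: `v b` for a single index, `v γ + v δ` for a pair. -/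
def entryVec {n : ℕ} (v : Fin n → V) : Fin n ⊕ (Fin n × Fin n) → V
  | Sum.inl b => v b
  | Sum.inr p => v p.1 + v p.2

/-- The leading index of an entry: `b` for a single index, `γ` for a pair `(γ, δ)`. -/
def entryLead {n : ℕ} : Fin n ⊕ (Fin n × Fin n) → Fin n
  | Sum.inl b => b
  | Sum.inr p => p.1

theorem entryVec_congr {n : ℕ} {v v' : Fin n → V} {e : Fin n ⊕ (Fin n × Fin n)}
    (h : ∀ i ∈ suppOf e, v' i = v i) : entryVec v' e = entryVec v e := by
  rcases e with b | ⟨γ, δ⟩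
  · exact h b (by simp [suppOf])
  · simp only [entryVec]
    rw [h γ (by simp [suppOf]), h δ (by simp [suppOf])]

/-- Adapted vectors and combinatorial data for the part of `U` and `W` inside `flag m`. -/
structure PartialAdapted {n : ℕ} (flag : ℕ → Submodule K V) (U W : Submodule K V) (m : ℕ)
    (v : Fin n → V) (A : Set (Fin n)) (E : Set (Fin n ⊕ (Fin n × Fin n))) : Prop where
  mem_flag : ∀ i : Fin n, (i : ℕ) < m → v i ∈ flag (i + 1) ∧ v i ∉ flag i
  lt_of_mem : ∀ i ∈ A, (i : ℕ) < m
  inf_left : U ⊓ flag m = Submodule.span K (v '' A)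
  inf_right : W ⊓ flag m = Submodule.span K (entryVec v '' E)
  lt_of_mem_supp : ∀ e ∈ E, ∀ i ∈ suppOf e, (i : ℕ) < m
  disjoint : ∀ e ∈ E, ∀ e' ∈ E, e ≠ e' → Disjoint (suppOf e) (suppOf e')
  pair : ∀ γ δ, Sum.inr (γ, δ) ∈ E → δ < γ ∧ γ ∈ A ∧ δ ∉ A

variable {n : ℕ} {flag : ℕ → Submodule K V} {U W : Submodule K V}

theorem IsCompleteFlag.sup_span_singleton [FiniteDimensional K V]
    (hF : IsCompleteFlag K V n flag) {m : ℕ} (hm : m < n) {z : V}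
    (hz : z ∈ flag (m + 1)) (hz' : z ∉ flag m) :
    flag m ⊔ Submodule.span K {z} = flag (m + 1) := by
  obtain ⟨-, -, hr, hmono⟩ := hF
  have hle : flag m ⊔ Submodule.span K {z} ≤ flag (m + 1) :=
    sup_le (hmono _ _ (Nat.le_succ m) hm) (by simpa using hz)
  refine Submodule.eq_of_le_of_finrank_le hle ?_
  have hlt : flag m < flag m ⊔ Submodule.span K {z} := by
    refine lt_of_le_of_ne le_sup_left fun h => hz' ?_
    rw [h]
    exact Submodule.mem_sup_right (Submodule.mem_span_singleton_self z)
  have h1 := Submodule.finrank_lt_finrank_of_lt hlt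
  rw [hr m hm.le] at h1
  rw [hr (m + 1) hm]
  exact h1

theorem IsCompleteFlag.inf_succ_eq [FiniteDimensional K V]
    (hF : IsCompleteFlag K V n flag) {m : ℕ} (hm : m < n) {X : Submodule K V} {z : V}
    (hX : z ∈ X) (hz : z ∈ flag (m + 1)) (hz' : z ∉ flag m) :
    X ⊓ flag (m + 1) = Submodule.span K {z} ⊔ X ⊓ flag m := by
  have h : Submodule.span K {z} ≤ X := by simpa using hX
  rw [← hF.sup_span_singleton hm hz hz', inf_comm X (flag m), ← sup_inf_assoc_of_le _ h,
    inf_comm, sup_comm]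

theorem IsCompleteFlag.inf_succ_eq_of_le (hF : IsCompleteFlag K V n flag) {m : ℕ} (hm : m < n)
    {X : Submodule K V} (h : X ⊓ flag (m + 1) ≤ flag m) : X ⊓ flag (m + 1) = X ⊓ flag m :=
  le_antisymm (le_inf inf_le_left h) (inf_le_inf_left X (hF.2.2.2 _ _ (Nat.le_succ m) hm))

theorem IsCompleteFlag.eq_span [FiniteDimensional K V] (hF : IsCompleteFlag K V n flag)
    {v : Fin n → V} (hv : ∀ i : Fin n, v i ∈ flag (i + 1) ∧ v i ∉ flag i) {m : ℕ} (hm : m ≤ n) :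
    flag m = Submodule.span K (v '' {j : Fin n | (j : ℕ) < m}) := by
  induction m with
  | zero => simp [hF.1]
  | succ m ih =>
    have hset : {j : Fin n | (j : ℕ) < m + 1} = insert ⟨m, hm⟩ {j : Fin n | (j : ℕ) < m} := by
      ext j
      simp [Fin.ext_iff]
      omega
    have h := hv ⟨m, hm⟩
    rw [hset, Set.image_insert_eq, Submodule.span_insert, ← ih (Nat.le_of_succ_le hm), sup_comm,
      hF.sup_span_singleton hm h.1 h.2]

/-- Modulo `S`, a vector of `flag m` can be moved to `0` or to a level `δ` of the flag at which
`S + flag δ` jumps. -/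
theorem IsCompleteFlag.exists_reduce [FiniteDimensional K V] (hF : IsCompleteFlag K V n flag)
    (S : Submodule K V) {m : ℕ} (hm : m ≤ n) {x : V} (hx : x ∈ S ⊔ flag m) :
    x ∈ S ∨ ∃ δ < m, ∃ y ∈ flag (δ + 1), y ∉ flag δ ∧ x - y ∈ S ∧
      ∀ z ∈ flag (δ + 1), z ∉ flag δ → z ∉ S := by
  induction m with
  | zero => left; simpa [hF.1] using hx
  | succ m ih =>
    by_cases hxm : x ∈ S ⊔ flag m
    · rcases ih (Nat.le_of_succ_le hm) hxm with h | ⟨δ, hδ, h⟩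
      · exact Or.inl h
      · exact Or.inr ⟨δ, hδ.trans (Nat.lt_succ_self m), h⟩
    · right
      obtain ⟨s, hs, y, hy, rfl⟩ := Submodule.mem_sup.1 hx
      refine ⟨m, Nat.lt_succ_self m, y, hy, fun h => hxm ?_, by simpa using hs,
        fun z hz hz' hzS => hxm ?_⟩
      · exact Submodule.add_mem_sup hs h
      · have hle : S ⊔ flag (m + 1) ≤ S ⊔ flag m := by
          rw [← hF.sup_span_singleton hm hz hz']
          exact sup_le le_sup_left (sup_le le_sup_right
            (le_sup_of_le_left (by simpa using hzS)))
        exact hle hx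

namespace PartialAdapted

variable {m : ℕ} {v v' : Fin n → V} {A : Set (Fin n)} {E : Set (Fin n ⊕ (Fin n × Fin n))}

theorem span_left_congr (h : ∀ i ∈ A, v' i = v i) :
    Submodule.span K (v' '' A) = Submodule.span K (v '' A) := by
  rw [Set.image_congr h]

theorem span_right_congr (h : ∀ e ∈ E, ∀ i ∈ suppOf e, v' i = v i) :
    Submodule.span K (entryVec v' '' E) = Submodule.span K (entryVec v '' E) := by
  rw [Set.image_congr fun e he => entryVec_congr (h e he)]

theorem vec_mem_left (h : PartialAdapted flag U W m v A E) {i : Fin n} (hi : i ∈ A) :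
    v i ∈ U ⊓ flag m := by
  rw [h.inf_left]
  exact Submodule.subset_span ⟨i, hi, rfl⟩

theorem vec_mem_sup (h : PartialAdapted flag U W m v A E) {e} (he : e ∈ E) {i : Fin n}
    (hi : i ∈ suppOf e) : v i ∈ U ⊓ flag m ⊔ W ⊓ flag m := by
  have hw : entryVec v e ∈ W ⊓ flag m := by
    rw [h.inf_right]
    exact Submodule.subset_span ⟨e, he, rfl⟩
  rcases e with b | ⟨γ, δ⟩
  · obtain rfl : i = b := by simpa [suppOf] using hi
    exact Submodule.mem_sup_right hw
  · have hγ : v γ ∈ U ⊓ flag m ⊔ W ⊓ flag m :=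
      Submodule.mem_sup_left (h.vec_mem_left (h.pair γ δ he).2.1)
    have hi' : i = γ ∨ i = δ := by simpa [suppOf] using hi
    rcases hi' with rfl | rfl
    · exact hγ
    · have := Submodule.sub_mem _ (Submodule.mem_sup_right (S := U ⊓ flag m) hw) hγ
      simpa [entryVec] using this

/-- Extend by one flag step, taking care of the vectors and of `U` and `W` separately. -/
theorem extend [FiniteDimensional K V] (hF : IsCompleteFlag K V n flag) (hm : m < n)
    (h : PartialAdapted flag U W m v A E)
    (hA : ∀ i ∈ A, v' i = v i) (hE : ∀ e ∈ E, ∀ i ∈ suppOf e, v' i = v i)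
    (hv' : ∀ i : Fin n, (i : ℕ) < m + 1 → v' i ∈ flag (i + 1) ∧ v' i ∉ flag i)
    {A' : Set (Fin n)} {E' : Set (Fin n ⊕ (Fin n × Fin n))}
    (hA' : A' = A ∧ U ⊓ flag (m + 1) ≤ flag m ∨ A' = insert ⟨m, hm⟩ A ∧ v' ⟨m, hm⟩ ∈ U)
    (hE' : E' = E ∧ W ⊓ flag (m + 1) ≤ flag m ∨
      (E' = insert (Sum.inl ⟨m, hm⟩) E ∧ v' ⟨m, hm⟩ ∈ W) ∨
      ∃ δ : Fin n, (δ : ℕ) < m ∧ E' = insert (Sum.inr (⟨m, hm⟩, δ)) E ∧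
        v' ⟨m, hm⟩ + v' δ ∈ W ∧ ⟨m, hm⟩ ∈ A' ∧ δ ∉ A ∧ ∀ e ∈ E, δ ∉ suppOf e) :
    PartialAdapted flag U W (m + 1) v' A' E' := by
  have hz := hv' ⟨m, hm⟩ (Nat.lt_succ_self m)
  have hmono := hF.2.2.2
  have hAsub : A ⊆ A' := by
    rcases hA' with ⟨rfl, -⟩ | ⟨rfl, -⟩
    · exact subset_rfl
    · exact Set.subset_insert _ _
  have hAlt : ∀ i ∈ A', i ∈ A ∨ i = ⟨m, hm⟩ := by
    rcases hA' with ⟨rfl, -⟩ | ⟨rfl, -⟩ <;> intro i hi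
    · exact Or.inl hi
    · exact hi.symm
  have hpair : ∀ γ δ, Sum.inr (γ, δ) ∈ E → δ < γ ∧ γ ∈ A' ∧ δ ∉ A' := by
    intro γ δ he
    obtain ⟨h1, h2, h3⟩ := h.pair γ δ he
    refine ⟨h1, hAsub h2, fun h4 => (hAlt δ h4).elim h3 ?_⟩
    rintro rfl
    exact absurd (h.lt_of_mem_supp _ he ⟨m, hm⟩ (by simp [suppOf])) (lt_irrefl m)
  have hnew : ∀ e ∈ E, (⟨m, hm⟩ : Fin n) ∉ suppOf e := fun e he hi =>
    lt_irrefl m (h.lt_of_mem_supp e he _ hi)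
  have hdisj : ∀ e₀, (∀ e ∈ E, Disjoint (suppOf e₀) (suppOf e)) →
      ∀ e ∈ insert e₀ E, ∀ e' ∈ insert e₀ E, e ≠ e' → Disjoint (suppOf e) (suppOf e') := by
    rintro e₀ h₀ e (rfl | he) e' (rfl | he') hne
    · exact absurd rfl hne
    · exact h₀ e' he'
    · exact (h₀ e he).symm
    · exact h.disjoint e he e' he' hne
  refine ⟨hv', fun i hi => ?_, ?_, ?_, ?_, ?_, ?_⟩
  · rcases hAlt i hi with hi | rfl
    · exact (h.lt_of_mem i hi).trans (Nat.lt_succ_self m)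
    · exact Nat.lt_succ_self m
  · rcases hA' with ⟨rfl, hle⟩ | ⟨rfl, hu⟩
    · rw [hF.inf_succ_eq_of_le hm hle, h.inf_left, span_left_congr hA]
    · rw [hF.inf_succ_eq hm hu hz.1 hz.2, Set.image_insert_eq, Submodule.span_insert,
        span_left_congr hA, h.inf_left]
  · rcases hE' with ⟨rfl, hle⟩ | ⟨rfl, hw⟩ | ⟨δ, hδ, rfl, hw, -⟩
    · rw [hF.inf_succ_eq_of_le hm hle, h.inf_right, span_right_congr hE]
    · rw [hF.inf_succ_eq hm hw hz.1 hz.2, Set.image_insert_eq, Submodule.span_insert,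
        span_right_congr hE, h.inf_right]
      rfl
    · have hδm : v' δ ∈ flag m :=
        hmono (δ + 1) m hδ hm.le (hv' δ (hδ.trans (Nat.lt_succ_self m))).1
      rw [hF.inf_succ_eq hm hw
        (Submodule.add_mem _ hz.1 (hmono m (m + 1) (Nat.le_succ m) hm hδm))
        (fun hc => hz.2 ((Submodule.add_mem_iff_left _ hδm).1 hc)), Set.image_insert_eq,
        Submodule.span_insert, span_right_congr hE, h.inf_right]
      rfl
  · have hold : ∀ e ∈ E, ∀ i ∈ suppOf e, (i : ℕ) < m + 1 := fun e he i hi =>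
      (h.lt_of_mem_supp e he i hi).trans (Nat.lt_succ_self m)
    rcases hE' with ⟨rfl, -⟩ | ⟨rfl, -⟩ | ⟨δ, hδ, rfl, -⟩
    · exact hold
    · rintro e (rfl | he) i hi
      · obtain rfl : i = ⟨m, hm⟩ := by simpa [suppOf] using hi
        exact Nat.lt_succ_self m
      · exact hold e he i hi
    · rintro e (rfl | he) i hi
      · have hi' : i = ⟨m, hm⟩ ∨ i = δ := by simpa [suppOf] using hi
        rcases hi' with rfl | rfl
        · exact Nat.lt_succ_self m
        · exact hδ.trans (Nat.lt_succ_self m)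
      · exact hold e he i hi
  · rcases hE' with ⟨rfl, -⟩ | ⟨rfl, -⟩ | ⟨δ, hδ, rfl, -, -, -, hδE⟩
    · exact h.disjoint
    · exact hdisj _ fun e he => by simpa [suppOf] using hnew e he
    · exact hdisj _ fun e he => by simpa [suppOf] using ⟨hnew e he, hδE e he⟩
  · rcases hE' with ⟨rfl, -⟩ | ⟨rfl, -⟩ | ⟨δ, hδ, rfl, -, hmA, hδA, -⟩
    · exact hpair
    · rintro γ δ (he | he)
      · cases he
      · exact hpair γ δ he
    · rintro γ δ' (he | he)
      · cases he
        refine ⟨hδ, hmA, fun hc => (hAlt _ hc).elim hδA ?_⟩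
        rintro rfl
        exact lt_irrefl m hδ
      · exact hpair γ δ' he

theorem exists_succ [FiniteDimensional K V] (hF : IsCompleteFlag K V n flag) (hm : m < n)
    (h : PartialAdapted flag U W m v A E) :
    ∃ (v' : Fin n → V) (A' : Set (Fin n)) (E' : Set (Fin n ⊕ (Fin n × Fin n))),
      PartialAdapted flag U W (m + 1) v' A' E' := by
  have hmono := hF.2.2.2
  let i₀ : Fin n := ⟨m, hm⟩
  have hne : ∀ i : Fin n, (i : ℕ) < m → i ≠ i₀ := by
    rintro i hi rfl
    exact lt_irrefl m hi
  have update_eq : ∀ (f : Fin n → V) (z : V) (i : Fin n), (i : ℕ) < m →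
      Function.update f i₀ z i = f i := fun f z i hi => Function.update_of_ne (hne i hi) _ _
  have update_mem : ∀ (f : Fin n → V) (z : V),
      (∀ i : Fin n, (i : ℕ) < m → f i ∈ flag (i + 1) ∧ f i ∉ flag i) →
      z ∈ flag (m + 1) → z ∉ flag m → ∀ i : Fin n, (i : ℕ) < m + 1 →
      Function.update f i₀ z i ∈ flag (i + 1) ∧ Function.update f i₀ z i ∉ flag i := by
    intro f z hf hz hz' i hi
    rcases Nat.lt_succ_iff_lt_or_eq.1 hi with hi | hi
    · rw [update_eq f z i hi]
      exact hf i hi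
    · obtain rfl : i = i₀ := Fin.ext hi
      rw [Function.update_self]
      exact ⟨hz, hz'⟩
  have simple : ∀ z ∈ flag (m + 1), z ∉ flag m →
      (U ⊓ flag (m + 1) ≤ flag m ∨ z ∈ U) → (W ⊓ flag (m + 1) ≤ flag m ∨ z ∈ W) →
      ∃ (v' : Fin n → V) (A' : Set (Fin n)) (E' : Set (Fin n ⊕ (Fin n × Fin n))),
        PartialAdapted flag U W (m + 1) v' A' E' := by
    intro z hz hz' hzU hzW
    have key : ∀ A' E', _ → _ → PartialAdapted flag U W (m + 1) (Function.update v i₀ z) A' E' :=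
      fun A' E' => h.extend hF hm (fun i hi => update_eq v z i (h.lt_of_mem i hi))
        (fun e he i hi => update_eq v z i (h.lt_of_mem_supp e he i hi))
        (update_mem v z h.mem_flag hz hz')
    have hs : Function.update v i₀ z i₀ = z := Function.update_self _ _ _
    rcases hzU with hU | hU <;> rcases hzW with hW | hW
    · exact ⟨_, _, _, key _ _ (Or.inl ⟨rfl, hU⟩) (Or.inl ⟨rfl, hW⟩)⟩
    · exact ⟨_, _, _, key _ _ (Or.inl ⟨rfl, hU⟩) (Or.inr (Or.inl ⟨rfl, hs.symm ▸ hW⟩))⟩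
    · exact ⟨_, _, _, key _ _ (Or.inr ⟨rfl, hs.symm ▸ hU⟩) (Or.inl ⟨rfl, hW⟩)⟩
    · exact ⟨_, _, _, key _ _ (Or.inr ⟨rfl, hs.symm ▸ hU⟩) (Or.inr (Or.inl ⟨rfl, hs.symm ▸ hW⟩))⟩
  by_cases hU : U ⊓ flag (m + 1) ≤ flag m
  · by_cases hW : W ⊓ flag (m + 1) ≤ flag m
    · have hlt : ¬ flag (m + 1) ≤ flag m := fun hle => by
        have := Submodule.finrank_mono hle
        rw [hF.2.2.1 _ hm, hF.2.2.1 _ hm.le] at this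
        omega
      obtain ⟨z, hz, hz'⟩ := SetLike.not_le_iff_exists.1 hlt
      exact simple z hz hz' (Or.inl hU) (Or.inl hW)
    · obtain ⟨z, hz, hz'⟩ := SetLike.not_le_iff_exists.1 hW
      exact simple z hz.2 hz' (Or.inl hU) (Or.inr hz.1)
  obtain ⟨u, ⟨huU, huF⟩, hu⟩ := SetLike.not_le_iff_exists.1 hU
  by_cases hW : W ⊓ flag (m + 1) ≤ flag m
  · exact simple u huF hu (Or.inr huU) (Or.inl hW)
  obtain ⟨w₀, ⟨hwW, hwF⟩, hw₀⟩ := SetLike.not_le_iff_exists.1 hW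
  -- Rescale so that `w - u` lies in `flag m`.
  obtain ⟨w, hw, hwu⟩ : ∃ w ∈ W, w - u ∈ flag m := by
    have : u ∈ flag m ⊔ Submodule.span K {w₀} := by rwa [hF.sup_span_singleton hm hwF hw₀]
    obtain ⟨x, hx, y, hy, hxy⟩ := Submodule.mem_sup.1 this
    obtain ⟨c, rfl⟩ := Submodule.mem_span_singleton.1 hy
    refine ⟨c • w₀, W.smul_mem c hwW, ?_⟩
    rw [← hxy]
    simpa using hx
  have add_mem : ∀ a ∈ flag m, u + a ∈ flag (m + 1) ∧ u + a ∉ flag m := fun a ha =>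
    ⟨Submodule.add_mem _ huF (hmono m (m + 1) (Nat.le_succ m) hm ha),
      fun hc => hu ((Submodule.add_mem_iff_left _ ha).1 hc)⟩
  rcases hF.exists_reduce (U ⊓ flag m ⊔ W ⊓ flag m) hm.le
    (Submodule.mem_sup_right hwu) with hS | ⟨δ, hδ, y, hy, hy', hS, hfree⟩
  · obtain ⟨a, ha, b, hb, hab⟩ := Submodule.mem_sup.1 hS
    have heq : u + a = w - b := by
      rw [eq_sub_iff_add_eq, add_assoc, hab]
      abel
    refine simple (u + a) (add_mem a ha.2).1 (add_mem a ha.2).2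
      (Or.inr (U.add_mem huU ha.1)) (Or.inr ?_)
    rw [heq]
    exact W.sub_mem hw hb.1
  · obtain ⟨a, ha, b, hb, hab⟩ := Submodule.mem_sup.1 hS
    have heq : u + a + y = w - b := by
      rw [eq_sub_iff_add_eq, show u + a + y + b = u + y + (a + b) by abel, hab]
      abel
    let d : Fin n := ⟨δ, hδ.trans hm⟩
    obtain ⟨hv1, hv2⟩ := h.mem_flag d hδ
    have hdS : v d ∉ U ⊓ flag m ⊔ W ⊓ flag m := hfree _ hv1 hv2
    have hdA : d ∉ A := fun hd => hdS (Submodule.mem_sup_left (h.vec_mem_left hd))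
    have hdE : ∀ e ∈ E, d ∉ suppOf e := fun e he hd => hdS (h.vec_mem_sup he hd)
    have hv' : ∀ i : Fin n, (i : ℕ) < m →
        Function.update v d y i ∈ flag (i + 1) ∧ Function.update v d y i ∉ flag i := by
      intro i hi
      by_cases hid : i = d
      · subst hid
        rw [Function.update_self]
        exact ⟨hy, hy'⟩
      · rw [Function.update_of_ne hid]
        exact h.mem_flag i hi
    refine ⟨Function.update (Function.update v d y) i₀ (u + a), insert i₀ A,
      insert (Sum.inr (i₀, d)) E, h.extend hF hm ?_ ?_
        (update_mem _ _ hv' (add_mem a ha.2).1 (add_mem a ha.2).2) (Or.inr ⟨rfl, ?_⟩)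
        (Or.inr (Or.inr ⟨d, hδ, rfl, ?_, Set.mem_insert _ _, hdA, hdE⟩))⟩
    · intro i hi
      rw [update_eq _ _ i (h.lt_of_mem i hi), Function.update_of_ne]
      rintro rfl
      exact hdA hi
    · intro e he i hi
      rw [update_eq _ _ i (h.lt_of_mem_supp e he i hi), Function.update_of_ne]
      rintro rfl
      exact hdE e he hi
    · rw [Function.update_self]
      exact U.add_mem huU ha.1
    · rw [Function.update_self, update_eq _ _ d hδ, Function.update_self, heq]
      exact W.sub_mem hw hb.1

theorem exists_of_le [FiniteDimensional K V] (hF : IsCompleteFlag K V n flag)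
    (U W : Submodule K V) (hm : m ≤ n) :
    ∃ (v : Fin n → V) (A : Set (Fin n)) (E : Set (Fin n ⊕ (Fin n × Fin n))),
      PartialAdapted flag U W m v A E := by
  induction m with
  | zero => exact ⟨0, ∅, ∅, by constructor <;> simp [hF.1]⟩
  | succ m ih =>
    obtain ⟨v, A, E, h⟩ := ih (Nat.le_of_succ_le hm)
    exact h.exists_succ hF hm

theorem linearIndependent_entryVec (h : PartialAdapted flag U W m v A E)
    (hv : LinearIndependent K v) (hs : ⊤ ≤ Submodule.span K (Set.range v)) :
    LinearIndependent K (fun e : E => entryVec v e) := by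
  let b := Module.Basis.mk hv hs
  have hcoord : ∀ i j, b.repr (v j) i = if j = i then 1 else 0 := by
    intro i j
    have : v j = b j := (Module.Basis.mk_apply hv hs j).symm
    rw [this, Module.Basis.repr_self, Finsupp.single_apply]
  have hvec : ∀ i e, i ∉ suppOf e → b.coord i (entryVec v e) = 0 := by
    rintro i (c | ⟨γ, δ⟩) hi
    · have : c ≠ i := by rintro rfl; simp [suppOf] at hi
      simp [entryVec, hcoord, this]
    · have h1 : γ ≠ i := by rintro rfl; simp [suppOf] at hi
      have h2 : δ ≠ i := by rintro rfl; simp [suppOf] at hi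
      simp [entryVec, hcoord, h1, h2]
  have hlead : ∀ e : Fin n ⊕ (Fin n × Fin n), entryLead e ∈ suppOf e := by
    rintro (c | ⟨γ, δ⟩) <;> simp [entryLead, suppOf]
  refine LinearIndependent.of_pairwise_dual_eq_zero_one _
    (fun e : E => b.coord (entryLead (e : Fin n ⊕ (Fin n × Fin n)))) ?_ ?_
  · intro e e' hne
    refine hvec _ _ fun hmem => ?_
    exact Finset.disjoint_left.1
      (h.disjoint e e.2 e' e'.2 fun heq => hne (Subtype.ext heq)) (hlead e) hmem
  · rintro ⟨c | ⟨γ, δ⟩, he⟩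
    · simp [entryVec, entryLead, hcoord]
    · have := (h.pair γ δ he).1.ne
      simp [entryVec, entryLead, hcoord, this]

end PartialAdapted

end AdaptedConstruction

/-- For every field `K`, every `n`-dimensional `K`-vector space `V` equipped
with a complete flag, and every pair of subspaces `U, W ⊆ V` with `dim U = k` and
`dim W = l`, there exists an adapted triple of ordered bases of `U`, `W` and `V`. -/
theorem exists_adapted_triple (K V : Type*) [Field K] [AddCommGroup V] [Module K V]
    [FiniteDimensional K V] (n k l : ℕ) (hV : Module.finrank K V = n)
    (flag : ℕ → Submodule K V) (hflag : IsCompleteFlag K V n flag)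
    (U W : Submodule K V) (hU : Module.finrank K U = k) (hW : Module.finrank K W = l) :
    Nonempty (AdaptedTriple K V n k l flag U W) := by
  classical
  obtain ⟨v, A, E, h⟩ := PartialAdapted.exists_of_le hflag U W le_rfl
  have hspan := fun m (hm : m ≤ n) => hflag.eq_span (fun i => h.mem_flag i i.2) hm
  have htop : ⊤ ≤ Submodule.span K (Set.range v) := by
    have := hspan n le_rfl
    rw [hflag.2.1] at this
    rw [this]
    exact Submodule.span_mono (Set.image_subset_range _ _)
  have hv : LinearIndependent K v :=
    linearIndependent_of_top_le_span_of_card_eq_finrank htop (by simp [hV])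
  have hu : LinearIndependent K (fun a : A => v a) := hv.comp _ Subtype.val_injective
  have hw := h.linearIndependent_entryVec hv htop
  have hUspan : Submodule.span K (Set.range fun a : A => v a) = U := by
    rw [← Set.image_eq_range, ← h.inf_left, hflag.2.1, inf_top_eq]
  have hWspan : Submodule.span K (Set.range fun e : E => entryVec v e) = W := by
    rw [← Set.image_eq_range, ← h.inf_right, hflag.2.1, inf_top_eq]
  have hAk : Fintype.card A = k := by rw [← finrank_span_eq_card hu, hUspan, hU]
  have hEl : Fintype.card E = l := by rw [← finrank_span_eq_card hw, hWspan, hW]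
  let f : Fin k ≃ A := (Fintype.equivFinOfCardEq hAk).symm
  let g : Fin l ≃ E := (Fintype.equivFinOfCardEq hEl).symm
  have hrange : Set.range (fun i => (f i : Fin n)) = A := by
    rw [← Function.comp_def, f.surjective.range_comp]
    exact Subtype.range_coe
  exact ⟨{
    v := v
    u := fun i => v (f i)
    w := fun i => entryVec v (g i)
    α := fun i => f i
    idx := fun i => g i
    hv_indep := hv
    hu_indep := hu.comp f f.injective
    hw_indep := hw.comp g g.injective
    hflag := hspan
    hu_span := by
      rw [← hUspan]
      exact congrArg _ (f.surjective.range_comp fun a : A => v a)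
    hw_span := by
      rw [← hWspan]
      exact congrArg _ (g.surjective.range_comp fun e : E => entryVec v e)
    hα := Subtype.val_injective.comp f.injective
    hu := fun _ => rfl
    hw_single := fun i b hi => by
      rw [hi]
      rfl
    hw_pair := fun i γ δ hi => by
      have hp := h.pair γ δ (hi ▸ (g i).2)
      rw [hrange, hi]
      exact ⟨rfl, hp.1, hp.2.1⟩
    hsupp := fun i j hij => h.disjoint _ (g i).2 _ (g j).2 fun heq =>
      hij (g.injective (Subtype.ext heq))
    hδ := fun i γ δ hi => by
      rw [hrange]
      exact (h.pair γ δ (hi ▸ (g i).2)).2.2 }⟩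
end

section
/- If (u, w, v) and (u′, w′, v′) are two adapted triples of ordered bases for the same complete flag V_• and the same pair of subspaces (U, W), then their associated combinatorial data coincide: ᾱ = ᾱ′, β̄ = β̄′, γ̄ = γ̄′, and σ = σ′. -/
namespace AdaptedTriple

variable {K V : Type*} [Field K] [AddCommGroup V] [Module K V]
variable {n k l : ℕ} {flag : ℕ → Submodule K V} {U W : Submodule K V}

/-- The index `a` is a jump of the filtration induced by `flag` on `X`. -/
def IsJump (flag : ℕ → Submodule K V) (X : Submodule K V) (a : ℕ) : Prop :=
  ∃ x ∈ X, x ∈ flag (a + 1) ∧ x ∉ flag a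

/-- The value of `sigmaFun` determined by the set of pairs being swapped. -/
noncomputable def swapFun (P : Fin n × Fin n → Prop) : Fin n → Fin n :=
  open Classical in fun x =>
    if h : ∃ p : Fin n × Fin n, P p ∧ (x = p.1 ∨ x = p.2) then
      (if x = h.choose.1 then h.choose.2 else h.choose.1)
    else x

theorem sigmaFun_eq_swapFun (T : AdaptedTriple K V n k l flag U W) :
    T.sigmaFun = swapFun fun p => ∃ i, T.idx i = Sum.inr p := by
  funext x
  unfold sigmaFun swapFun
  congr

theorem exists_basis (T : AdaptedTriple K V n k l flag U W) (htop : flag n = ⊤) :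
    ∃ b : Module.Basis (Fin n) K V, ⇑b = T.v := by
  refine ⟨Module.Basis.mk T.hv_indep ?_, Module.Basis.coe_mk _ _⟩
  rw [← htop, T.hflag n le_rfl]
  exact Submodule.span_mono (Set.image_subset_range _ _)

section Basis

variable (T : AdaptedTriple K V n k l flag U W) {b : Module.Basis (Fin n) K V}

theorem mem_flag_iff (hb : ⇑b = T.v) {m : ℕ} (hm : m ≤ n) {x : V} :
    x ∈ flag m ↔ ∀ j : Fin n, b.repr x j ≠ 0 → (j : ℕ) < m := by
  rw [T.hflag m hm, ← hb, b.mem_span_image]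
  simp [Set.subset_def]

theorem U_eq_span (hb : ⇑b = T.v) : U = Submodule.span K (b '' Set.range T.α) := by
  have h : T.u = T.v ∘ T.α := funext T.hu
  rw [← Set.range_comp, hb, ← h, T.hu_span]

theorem mem_U_sup_flag_iff (hb : ⇑b = T.v) {m : ℕ} (hm : m ≤ n) {x : V} :
    x ∈ U ⊔ flag m ↔ ∀ j : Fin n, b.repr x j ≠ 0 → j ∈ Set.range T.α ∨ (j : ℕ) < m := by
  have h : U ⊔ flag m = Submodule.span K (b '' (Set.range T.α ∪ {j | (j : ℕ) < m})) := by
    rw [Set.image_union, Submodule.span_union, ← T.U_eq_span hb, T.hflag m hm, hb]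
  rw [h, b.mem_span_image]
  simp [Set.subset_def]

theorem mem_flag_succ_and_notMem_iff (hb : ⇑b = T.v) (g : Fin n) {x : V} :
    (x ∈ flag (g + 1) ∧ x ∉ flag g) ↔ b.repr x g ≠ 0 ∧ ∀ j, b.repr x j ≠ 0 → j ≤ g := by
  rw [T.mem_flag_iff hb (by lia), T.mem_flag_iff hb (by lia)]
  push Not
  constructor
  · rintro ⟨h, j, hj, hgj⟩
    have : j = g := by have := h j hj; lia
    exact ⟨this ▸ hj, fun i hi => by have := h i hi; lia⟩
  · rintro ⟨hg, h⟩
    exact ⟨fun j hj => by have := h j hj; lia, g, hg, le_rfl⟩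

theorem repr_w (hb : ⇑b = T.v) (i : Fin l) (j : Fin n) :
    b.repr (T.w i) j = if j ∈ suppOf (T.idx i) then 1 else 0 := by
  rcases h : T.idx i with c | ⟨γ, δ⟩
  · rw [T.hw_single i c h, ← hb]
    simp [suppOf, Finsupp.single_apply, eq_comm]
  · obtain ⟨hw, hlt, -⟩ := T.hw_pair i γ δ h
    rw [hw, ← hb]
    simp only [suppOf, map_add, Module.Basis.repr_self, Finsupp.add_apply, Finsupp.single_apply,
      Finset.mem_insert, Finset.mem_singleton]
    grind

theorem repr_eq_of_mem_suppOf (hb : ⇑b = T.v) {x : V} (hx : x ∈ W) {i : Fin l} {j j' : Fin n}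
    (hj : j ∈ suppOf (T.idx i)) (hj' : j' ∈ suppOf (T.idx i)) :
    b.repr x j = b.repr x j' := by
  rw [← T.hw_span] at hx
  induction hx using Submodule.span_induction with
  | mem x hx =>
    obtain ⟨i', rfl⟩ := hx
    rw [T.repr_w hb, T.repr_w hb]
    by_cases h : i = i'
    · subst h; simp [hj, hj']
    · have := Finset.disjoint_left.1 (T.hsupp i i' h)
      simp [this hj, this hj']
  | zero => simp
  | add x y _ _ hx hy => simp [hx, hy]
  | smul a x _ hx => simp [hx]

theorem exists_mem_suppOf (hb : ⇑b = T.v) {x : V} (hx : x ∈ W) {j : Fin n}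
    (hj : b.repr x j ≠ 0) : ∃ i, j ∈ suppOf (T.idx i) := by
  by_contra! h
  apply hj
  rw [← T.hw_span] at hx
  clear hj
  induction hx using Submodule.span_induction with
  | mem x hx =>
    obtain ⟨i', rfl⟩ := hx
    simp [T.repr_w hb, h]
  | zero => simp
  | add x y _ _ hx hy => simp [hx, hy]
  | smul a x _ hx => simp [hx]

end Basis

theorem mem_alphaSet_iff (T : AdaptedTriple K V n k l flag U W) (htop : flag n = ⊤)
    (a : Fin n) : a ∈ T.alphaSet ↔ IsJump flag U a := by
  obtain ⟨b, hb⟩ := T.exists_basis htop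
  have hU (x : V) : x ∈ U ↔ ↑(b.repr x).support ⊆ Set.range T.α := by
    rw [← b.mem_span_image, ← T.U_eq_span hb]
  simp only [IsJump, T.mem_flag_succ_and_notMem_iff hb, hU, alphaSet]
  constructor
  · intro ha
    refine ⟨b a, ?_, ?_, ?_⟩
    · intro j hj
      have : j = a := by simpa [Finsupp.single_apply, eq_comm] using hj
      exact this ▸ ha
    · simp
    · intro j hj
      have : a = j := by simpa [Finsupp.single_apply] using hj
      exact this.ge
  · rintro ⟨x, hx, hxa, -⟩
    exact hx (by simpa using hxa)

theorem isJump_inf_sup_iff (T : AdaptedTriple K V n k l flag U W) (htop : flag n = ⊤)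
    (g : Fin n) {m : ℕ} (hm : m ≤ n) :
    IsJump flag (W ⊓ (U ⊔ flag m)) g ↔ ∃ i,
      (T.idx i = Sum.inl g ∧ (g ∈ Set.range T.α ∨ (g : ℕ) < m)) ∨
        ∃ δ : Fin n, T.idx i = Sum.inr (g, δ) ∧ (δ : ℕ) < m := by
  obtain ⟨b, hb⟩ := T.exists_basis htop
  simp only [IsJump, T.mem_flag_succ_and_notMem_iff hb, Submodule.mem_inf,
    T.mem_U_sup_flag_iff hb hm]
  constructor
  · rintro ⟨x, ⟨hxW, hx⟩, hg, hlead⟩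
    obtain ⟨i, hi⟩ := T.exists_mem_suppOf hb hxW hg
    refine ⟨i, ?_⟩
    rcases h : T.idx i with c | ⟨γ, δ⟩
    · have : g = c := by simpa [h, suppOf] using hi
      subst this
      exact Or.inl ⟨rfl, hx g hg⟩
    · obtain ⟨-, hlt, -⟩ := T.hw_pair i γ δ h
      have hγ : γ ∈ suppOf (T.idx i) := by simp [h, suppOf]
      have hδ : δ ∈ suppOf (T.idx i) := by simp [h, suppOf]
      have hγ0 : b.repr x γ ≠ 0 := T.repr_eq_of_mem_suppOf hb hxW hi hγ ▸ hg
      have hδ0 : b.repr x δ ≠ 0 := T.repr_eq_of_mem_suppOf hb hxW hi hδ ▸ hg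
      have hgi : g = γ ∨ g = δ := by simpa [h, suppOf] using hi
      obtain rfl : g = γ := by
        rcases hgi with h1 | rfl
        · exact h1
        · exact absurd (hlead γ hγ0) hlt.not_ge
      exact Or.inr ⟨δ, rfl, (hx δ hδ0).resolve_left (T.hδ i g δ h)⟩
  · rintro ⟨i, hi⟩
    have hwW : T.w i ∈ W := T.hw_span.le (Submodule.subset_span ⟨i, rfl⟩)
    refine ⟨T.w i, ⟨hwW, ?_⟩, ?_⟩
    all_goals simp only [T.repr_w hb]
    · intro j hj
      rcases hi with ⟨h, hg⟩ | ⟨δ, h, hδ⟩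
      · have : j = g := by simpa [h, suppOf] using hj
        exact this ▸ hg
      · have : j = g ∨ j = δ := by simpa [h, suppOf, or_iff_not_imp_left] using hj
        rcases this with rfl | rfl
        · exact Or.inl (T.hw_pair i _ _ h).2.2
        · exact Or.inr hδ
    · rcases hi with ⟨h, -⟩ | ⟨δ, h, -⟩
      · simp +contextual [h, suppOf]
      · have := (T.hw_pair i _ _ h).2.1.le
        refine ⟨by simp [h, suppOf], fun j hj => ?_⟩
        have hjg : j = g ∨ j = δ := by simpa [h, suppOf, or_iff_not_imp_left] using hj
        exact hjg.elim Eq.le fun hjd => hjd ▸ this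

theorem eq_of_mem_suppOf (T : AdaptedTriple K V n k l flag U W) {i j : Fin l} {g : Fin n}
    (hi : g ∈ suppOf (T.idx i)) (hj : g ∈ suppOf (T.idx j)) : i = j := by
  by_contra h
  exact Finset.disjoint_left.1 (T.hsupp i j h) hi hj

theorem exists_idx_eq_inr_iff (T : AdaptedTriple K V n k l flag U W) (htop : flag n = ⊤)
    (p : Fin n × Fin n) :
    (∃ i, T.idx i = Sum.inr p) ↔ p.2 < p.1 ∧
      IsJump flag (W ⊓ (U ⊔ flag (p.2 + 1))) p.1 ∧ ¬ IsJump flag (W ⊓ (U ⊔ flag p.2)) p.1 := by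
  obtain ⟨g, d⟩ := p
  rw [T.isJump_inf_sup_iff htop g (by lia), T.isJump_inf_sup_iff htop g (by lia)]
  constructor
  · rintro ⟨i, h⟩
    refine ⟨(T.hw_pair i _ _ h).2.1, ⟨i, Or.inr ⟨d, h, by simp⟩⟩, ?_⟩
    rintro ⟨i', ⟨h', -⟩ | ⟨δ, h', hδ⟩⟩ <;>
      obtain rfl : i = i' :=
        T.eq_of_mem_suppOf (g := g) (by simp [h, suppOf]) (by simp [h', suppOf])
    · simp [h] at h'
    · simp only [h, Sum.inr.injEq, Prod.mk.injEq, true_and] at h'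
      simp [h'] at hδ
  · rintro ⟨hlt, ⟨i, hi⟩, hno⟩
    push Not at hno
    obtain ⟨hno1, hno2⟩ := hno i
    refine ⟨i, ?_⟩
    rcases hi with ⟨h, hg⟩ | ⟨δ, h, hδ⟩
    · have := (hno1 h).1
      have h2 := hg.resolve_left this
      simp only at hlt h2
      lia
    · have := hno2 δ h
      simp only at hδ this
      obtain rfl : δ = d := by lia
      exact h

theorem mem_betaSet_iff (T : AdaptedTriple K V n k l flag U W) (htop : flag n = ⊤)
    (g : Fin n) :
    g ∈ T.betaSet ↔ IsJump flag (W ⊓ (U ⊔ flag n)) g ∧ g ∉ T.gammaSet := by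
  rw [T.isJump_inf_sup_iff htop g le_rfl]
  simp only [betaSet, gammaSet, Set.mem_ofPred_eq]
  constructor
  · rintro ⟨i, h⟩
    refine ⟨⟨i, Or.inl ⟨h, Or.inr g.2⟩⟩, ?_⟩
    rintro ⟨i', δ, h'⟩
    obtain rfl : i = i' :=
      T.eq_of_mem_suppOf (g := g) (by simp [h, suppOf]) (by simp [h', suppOf])
    simp [h] at h'
  · rintro ⟨⟨i, ⟨h, -⟩ | ⟨δ, h, -⟩⟩, hno⟩
    · exact ⟨i, h⟩
    · exact absurd ⟨i, δ, h⟩ hno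

end AdaptedTriple

/-- Two adapted triples of ordered bases for the same complete flag and the
same pair of subspaces `(U, W)` have the same associated combinatorial data
`(ᾱ, β̄, γ̄, σ)`. -/
theorem adaptedTriple_combinatorial_data_unique
    (K V : Type*) [Field K] [AddCommGroup V] [Module K V] [FiniteDimensional K V]
    (n k l : ℕ) (hV : Module.finrank K V = n)
    (flag : ℕ → Submodule K V) (hflag : IsCompleteFlag K V n flag)
    (U W : Submodule K V) (hU : Module.finrank K U = k) (hW : Module.finrank K W = l)
    (T T' : AdaptedTriple K V n k l flag U W) :
    T.alphaSet = T'.alphaSet ∧ T.betaSet = T'.betaSet ∧ T.gammaSet = T'.gammaSet ∧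
      T.sigmaFun = T'.sigmaFun := by
  have htop := hflag.2.1
  have hpair : ∀ p, (∃ i, T.idx i = Sum.inr p) ↔ ∃ i, T'.idx i = Sum.inr p := fun p => by
    rw [T.exists_idx_eq_inr_iff htop, T'.exists_idx_eq_inr_iff htop]
  have hγ : T.gammaSet = T'.gammaSet := by
    ext g
    simp only [AdaptedTriple.gammaSet, Set.mem_ofPred_eq]
    rw [exists_comm, exists_comm (α := Fin l)]
    exact exists_congr fun δ => hpair (g, δ)
  refine ⟨?_, ?_, hγ, ?_⟩
  · ext a
    rw [T.mem_alphaSet_iff htop, T'.mem_alphaSet_iff htop]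
  · ext g
    rw [T.mem_betaSet_iff htop, T'.mem_betaSet_iff htop, hγ]
  · rw [T.sigmaFun_eq_swapFun, T'.sigmaFun_eq_swapFun]
    exact congrArg _ (funext fun p => propext (hpair p))
end

section
/- If (u, w, v) is an adapted triple of ordered bases for (U, W) with respect to the flag V_•, with associated combinatorial data (ᾱ, β̄, γ̄, σ), then ᾱ = {i ∈ {1,…,n} : dim(U ∩ V_i) > dim(U ∩ V_{i−1})}. -/
theorem LinearIndependent.span_image_inf_span_image {ι K V : Type*} [Field K] [AddCommGroup V]
    [Module K V] {v : ι → V} (hv : LinearIndependent K v) (s t : Set ι) :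
    Submodule.span K (v '' s) ⊓ Submodule.span K (v '' t) = Submodule.span K (v '' (s ∩ t)) := by
  simp only [Finsupp.span_image_eq_map_linearCombination, Finsupp.supported_inter]
  exact (Submodule.map_inf _ hv).symm

theorem AdaptedTriple.inf_flag_eq_span {K V : Type*} [Field K] [AddCommGroup V] [Module K V]
    {n k l : ℕ} {flag : ℕ → Submodule K V} {U W : Submodule K V}
    (T : AdaptedTriple K V n k l flag U W) {m : ℕ} (hm : m ≤ n) :
    U ⊓ flag m = Submodule.span K (T.v '' (T.alphaSet ∩ {j : Fin n | (j : ℕ) < m})) := by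
  have hU : U = Submodule.span K (T.v '' T.alphaSet) := by
    refine T.hu_span.symm.trans ?_
    rw [AdaptedTriple.alphaSet, ← Set.range_comp]
    exact congrArg (fun f => Submodule.span K (Set.range f)) (funext T.hu)
  rw [T.hflag m hm, ← T.hv_indep.span_image_inf_span_image, ← hU]

/-- For an adapted triple for `(U, W)` with respect to the flag `V_•`,
the set `ᾱ` equals `{i : dim (U ∩ V_i) > dim (U ∩ V_{i-1})}` (here, with `0`-based
indexing, `j ∈ ᾱ` iff `dim (U ∩ V_{j+1}) > dim (U ∩ V_j)`). -/
theorem alphaSet_eq_jumps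
    (K V : Type*) [Field K] [AddCommGroup V] [Module K V] [FiniteDimensional K V]
    (n k l : ℕ) (hV : Module.finrank K V = n)
    (flag : ℕ → Submodule K V) (hflag : IsCompleteFlag K V n flag)
    (U W : Submodule K V) (hU : Module.finrank K U = k) (hW : Module.finrank K W = l)
    (T : AdaptedTriple K V n k l flag U W) :
    T.alphaSet = {i : Fin n |
      Module.finrank K ↥(U ⊓ flag ((i : ℕ) + 1)) > Module.finrank K ↥(U ⊓ flag (i : ℕ))} := by
  ext i
  rw [Set.mem_ofPred_eq, T.inf_flag_eq_span i.isLt, T.inf_flag_eq_span i.isLt.le]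
  constructor
  · intro hi
    apply Submodule.finrank_lt_finrank_of_lt
    refine lt_of_le_of_ne (Submodule.span_mono (Set.image_mono fun j hj =>
      ⟨hj.1, Nat.lt_succ_of_lt hj.2⟩)) fun heq => ?_
    have hmem : T.v i ∈ Submodule.span K
        (T.v '' (T.alphaSet ∩ {j : Fin n | (j : ℕ) < (i : ℕ) + 1})) :=
      Submodule.subset_span ⟨i, ⟨hi, Nat.lt_succ_self _⟩, rfl⟩
    rw [← heq] at hmem
    exact T.hv_indep.notMem_span_image (fun h => lt_irrefl (i : ℕ) h.2) hmem
  · intro hlt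
    by_contra hi
    have hset : T.alphaSet ∩ {j : Fin n | (j : ℕ) < (i : ℕ) + 1} =
        T.alphaSet ∩ {j : Fin n | (j : ℕ) < (i : ℕ)} := by
      ext j
      refine and_congr_right fun hj => ?_
      have hne : (j : ℕ) ≠ i := fun h => hi (Fin.ext h ▸ hj)
      change (j : ℕ) < (i : ℕ) + 1 ↔ (j : ℕ) < (i : ℕ)
      omega
    rw [hset] at hlt
    exact lt_irrefl _ hlt
end

section
/- If (u, w, v) is an adapted triple of ordered bases for (U, W) with respect to the flag V_•, with associated combinatorial data (ᾱ, β̄, γ̄, σ), then dim(U ∩ W) = #(ᾱ ∩ β̄); moreover U ∩ W = span{v_j : j ∈ ᾱ ∩ β̄}. -/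
namespace AdaptedTriple

variable {K V : Type*} [Field K] [AddCommGroup V] [Module K V]
variable {n k l : ℕ} {flag : ℕ → Submodule K V} {U W : Submodule K V}

theorem span_range_v (T : AdaptedTriple K V n k l flag U W) (h : flag n = ⊤) :
    Submodule.span K (Set.range T.v) = ⊤ := by
  have hn := T.hflag n le_rfl
  rw [← h, hn, ← Set.image_univ]
  congr 2
  ext j
  simp

theorem span_v_image_alphaSet (T : AdaptedTriple K V n k l flag U W) :
    Submodule.span K (T.v '' T.alphaSet) = U := by
  have hu : T.v ∘ T.α = T.u := funext fun i => (T.hu i).symm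
  rw [alphaSet, ← Set.range_comp, hu, T.hu_span]

/-- The basis of `V` given by the vectors `v` of an adapted triple. -/
noncomputable def basisV (T : AdaptedTriple K V n k l flag U W) (h : flag n = ⊤) :
    Module.Basis (Fin n) K V :=
  Module.Basis.mk T.hv_indep (T.span_range_v h).ge

theorem coe_basisV (T : AdaptedTriple K V n k l flag U W) (h : flag n = ⊤) :
    ⇑(T.basisV h) = T.v :=
  Module.Basis.coe_mk _ _

theorem repr_v (T : AdaptedTriple K V n k l flag U W) (h : flag n = ⊤) (j : Fin n) :
    (T.basisV h).repr (T.v j) = Finsupp.single j 1 := by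
  rw [← T.coe_basisV h, Module.Basis.repr_self]

/-- The index at which `w i` has coordinate one and all other `w j` have coordinate zero:
`β` for `w i = v β`, and `δ` for `w i = v γ + v δ`. -/
def pivot (T : AdaptedTriple K V n k l flag U W) (i : Fin l) : Fin n :=
  Sum.elim id Prod.snd (T.idx i)

theorem pivot_mem_suppOf (T : AdaptedTriple K V n k l flag U W) (i : Fin l) :
    T.pivot i ∈ suppOf (T.idx i) := by
  unfold pivot
  rcases T.idx i with b | ⟨γ, δ⟩ <;> simp [suppOf]

theorem repr_w_eq_zero (T : AdaptedTriple K V n k l flag U W) (h : flag n = ⊤)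
    {i : Fin l} {j : Fin n} (hj : j ∉ suppOf (T.idx i)) :
    (T.basisV h).repr (T.w i) j = 0 := by
  rcases hi : T.idx i with b | ⟨γ, δ⟩ <;> rw [hi] at hj
  · rw [T.hw_single i b hi, T.repr_v]
    exact Finsupp.single_eq_of_ne (by simpa [suppOf] using hj)
  · simp only [suppOf, Finset.mem_insert, Finset.mem_singleton, not_or] at hj
    rw [(T.hw_pair i γ δ hi).1, map_add, T.repr_v, T.repr_v, Finsupp.add_apply,
      Finsupp.single_eq_of_ne hj.1, Finsupp.single_eq_of_ne hj.2, add_zero]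

theorem repr_w_pivot (T : AdaptedTriple K V n k l flag U W) (h : flag n = ⊤) (i : Fin l) :
    (T.basisV h).repr (T.w i) (T.pivot i) = 1 := by
  rcases hi : T.idx i with b | ⟨γ, δ⟩
  · rw [T.hw_single i b hi, T.repr_v]
    simp [pivot, hi]
  · obtain ⟨hw, hlt, -⟩ := T.hw_pair i γ δ hi
    rw [hw, map_add, T.repr_v, T.repr_v]
    simp [pivot, hi, hlt.ne]

theorem repr_sum_pivot (T : AdaptedTriple K V n k l flag U W) (h : flag n = ⊤)
    (c : Fin l → K) (i : Fin l) :
    (T.basisV h).repr (∑ j, c j • T.w j) (T.pivot i) = c i := by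
  rw [map_sum, Finsupp.finsetSum_apply, Finset.sum_eq_single i]
  · simp [T.repr_w_pivot h i]
  · intro j _ hji
    have hnot : T.pivot i ∉ suppOf (T.idx j) :=
      Finset.disjoint_left.mp (T.hsupp i j hji.symm) (T.pivot_mem_suppOf i)
    simp [T.repr_w_eq_zero h hnot]
  · simp

theorem inf_eq_span (T : AdaptedTriple K V n k l flag U W) (h : flag n = ⊤) :
    U ⊓ W = Submodule.span K (T.v '' (T.alphaSet ∩ T.betaSet)) := by
  apply le_antisymm
  · rintro x ⟨hxU, hxW⟩
    obtain ⟨c, rfl⟩ :=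
      (Submodule.mem_span_range_iff_exists_fun K).mp (T.hw_span.ge hxW)
    replace hxU := T.span_v_image_alphaSet.ge hxU
    rw [← T.coe_basisV h, Module.Basis.mem_span_image] at hxU
    have hc (i : Fin l) (hi : c i ≠ 0) : T.pivot i ∈ T.alphaSet :=
      hxU (Finsupp.mem_support_iff.mpr (by rwa [T.repr_sum_pivot h c i]))
    refine Submodule.sum_mem _ fun i _ => ?_
    by_cases hci : c i = 0
    · simp [hci]
    apply Submodule.smul_mem
    have hpivot := hc i hci
    rcases hi : T.idx i with b | ⟨γ, δ⟩ <;>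
      simp only [pivot, hi, Sum.elim_inl, Sum.elim_inr] at hpivot
    · rw [T.hw_single i b hi]
      exact Submodule.subset_span ⟨b, ⟨hpivot, i, hi⟩, rfl⟩
    · exact absurd hpivot (T.hδ i γ δ hi)
  · rw [Submodule.span_le]
    rintro _ ⟨j, ⟨hjα, i, hi⟩, rfl⟩
    exact ⟨T.span_v_image_alphaSet.le (Submodule.subset_span ⟨j, hjα, rfl⟩),
      T.hw_span.le (Submodule.subset_span ⟨i, T.hw_single i j hi⟩)⟩

theorem finrank_span_v_image (T : AdaptedTriple K V n k l flag U W) (s : Set (Fin n)) :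
    Module.finrank K (Submodule.span K (T.v '' s)) = s.ncard := by
  classical
  have hs : LinearIndependent K fun j : s => T.v j :=
    T.hv_indep.comp _ Subtype.val_injective
  rw [Set.image_eq_range, finrank_span_eq_card hs, ← Nat.card_eq_fintype_card,
    Nat.card_coe_set_eq]

end AdaptedTriple

/-- For an adapted triple for `(U, W)` with respect to the flag `V_•`,
with combinatorial data `(ᾱ, β̄, γ̄, σ)`, one has `dim (U ∩ W) = #(ᾱ ∩ β̄)`; moreover
`U ∩ W = span {v_j : j ∈ ᾱ ∩ β̄}`. -/
theorem finrank_inf_eq_ncard_alpha_inter_beta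
    (K V : Type*) [Field K] [AddCommGroup V] [Module K V] [FiniteDimensional K V]
    (n k l : ℕ) (hV : Module.finrank K V = n)
    (flag : ℕ → Submodule K V) (hflag : IsCompleteFlag K V n flag)
    (U W : Submodule K V) (hU : Module.finrank K U = k) (hW : Module.finrank K W = l)
    (T : AdaptedTriple K V n k l flag U W) :
    Module.finrank K ↥(U ⊓ W) = (T.alphaSet ∩ T.betaSet).ncard ∧
      U ⊓ W = Submodule.span K (T.v '' (T.alphaSet ∩ T.betaSet)) := by
  have hspan := T.inf_eq_span hflag.2.1
  exact ⟨by rw [hspan, T.finrank_span_v_image], hspan⟩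
end

section
/- Let (U, W) be the canonical configuration attached to combinatorial data (ᾱ, β̄, γ̄, σ) of type (n,k,l). An invertible upper-triangular matrix A = (a_{ij}) ∈ GL(n,K) satisfies A·U = U and A·W = W if and only if the following hold (with the convention a_{ij} = 0 for i > j): (1) a_{iα} = 0 for all α ∈ ᾱ and i ∉ ᾱ; (2) a_{jβ} = 0 for all β ∈ β̄ and j ∉ β̄ ∪ γ̄ ∪ σ(γ̄); (3) a_{γβ} = a_{σ(γ)β} for all β ∈ β̄ and γ ∈ γ̄; (4) a_{jγ} + a_{jσ(γ)} = 0 for all γ ∈ γ̄ and j ∉ β̄ ∪ γ̄ ∪ σ(γ̄); (5) a_{γ′γ} + a_{γ′σ(γ)} = a_{σ(γ′)γ} + a_{σ(γ′)σ(γ)} for all γ, γ′ ∈ γ̄ (in particular, taking γ′ = γ and using (1), a_{γγ} = a_{σ(γ)σ(γ)} for all γ ∈ γ̄). -/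
/-- *Combinatorial data of type `(n, k, l)`*: sets `ᾱ, β̄, γ̄ ⊆ {1,…,n}` (encoded in `Fin n`)
with `#ᾱ = k`, `#β̄ + #γ̄ = l`, `γ̄ ⊆ ᾱ`, `β̄ ∩ γ̄ = ∅`, together with an involutive
permutation `σ` of `{1,…,n}` which is the product of the disjoint transpositions
`(γ, σ γ)` over `γ ∈ γ̄` (so `σ` fixes everything outside `γ̄ ∪ σ(γ̄)`), such that
`σ γ < γ` and `σ γ ∉ ᾱ ∪ β̄ ∪ γ̄` for every `γ ∈ γ̄`. -/
structure CombData (n k l : ℕ) where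
  A : Finset (Fin n)
  B : Finset (Fin n)
  C : Finset (Fin n)
  σ : Equiv.Perm (Fin n)
  hA : A.card = k
  hBC : B.card + C.card = l
  hCA : C ⊆ A
  hdisj : Disjoint B C
  hinv : ∀ x, σ (σ x) = x
  hsupp : ∀ x, σ x ≠ x → x ∈ C ∨ ∃ γ ∈ C, x = σ γ
  hlt : ∀ γ ∈ C, σ γ < γ
  hout : ∀ γ ∈ C, σ γ ∉ A ∧ σ γ ∉ B ∧ σ γ ∉ C

/-- `U` of the canonical configuration attached to combinatorial data:
`U = span {e_a : a ∈ ᾱ}` in `K^n`. -/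
def canonU (K : Type*) [Field K] {n k l : ℕ} (d : CombData n k l) :
    Submodule K (Fin n → K) :=
  Submodule.span K ((fun a => (Pi.single a 1 : Fin n → K)) '' ↑d.A)

/-- `W` of the canonical configuration attached to combinatorial data:
`W = span ({e_b : b ∈ β̄} ∪ {e_γ + e_{σ γ} : γ ∈ γ̄})` in `K^n`. -/
def canonW (K : Type*) [Field K] {n k l : ℕ} (d : CombData n k l) :
    Submodule K (Fin n → K) :=
  Submodule.span K
    (((fun b => (Pi.single b 1 : Fin n → K)) '' ↑d.B) ∪
      ((fun g => (Pi.single g 1 + Pi.single (d.σ g) 1 : Fin n → K)) '' ↑d.C))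

theorem mem_canonU_iff {K : Type*} [Field K] {n k l : ℕ} (d : CombData n k l) (v : Fin n → K) :
    v ∈ canonU K d ↔ ∀ i, i ∉ d.A → v i = 0 := by
  constructor
  · intro hv i hi
    refine Submodule.span_induction ?_ rfl (fun x y _ _ hx hy => by simp [hx, hy])
      (fun c x _ hx => by simp [hx]) hv
    rintro _ ⟨a, ha, rfl⟩
    exact Pi.single_eq_of_ne (fun h : i = a => hi (h ▸ ha)) 1
  · intro h
    have hv : v = ∑ a ∈ d.A, v a • (Pi.single a 1 : Fin n → K) := by
      ext i
      by_cases hi : i ∈ d.A <;> simp [Finset.sum_apply, Pi.single_apply, hi, h]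
    rw [hv]
    exact Submodule.sum_mem _ fun a ha =>
      Submodule.smul_mem _ _ (Submodule.subset_span ⟨a, ha, rfl⟩)

theorem mem_canonW_iff {K : Type*} [Field K] {n k l : ℕ} (d : CombData n k l) (v : Fin n → K) :
    v ∈ canonW K d ↔
      (∀ j, j ∉ d.B → j ∉ d.C → (∀ γ ∈ d.C, j ≠ d.σ γ) → v j = 0) ∧
        ∀ γ ∈ d.C, v γ = v (d.σ γ) := by
  constructor
  · intro hv
    refine Submodule.span_induction ?_ (by simp) ?_ ?_ hv
    · rintro _ (⟨b, hb, rfl⟩ | ⟨g, hg, rfl⟩)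
      · refine ⟨fun j hj _ _ => Pi.single_eq_of_ne (fun h : j = b => hj (h ▸ hb)) 1, fun γ hγ => ?_⟩
        have h₁ : γ ≠ b := fun h => Finset.disjoint_left.mp d.hdisj hb (h ▸ hγ)
        have h₂ : d.σ γ ≠ b := fun h => (d.hout γ hγ).2.1 (h ▸ hb)
        simp [h₁, h₂]
      · refine ⟨fun j _ hj hσ => ?_, fun γ hγ => ?_⟩
        · have h₁ : j ≠ g := fun h => hj (h ▸ hg)
          simp [h₁, hσ g hg]
        · have h₁ : d.σ γ ≠ g := fun h => (d.hout γ hγ).2.2 (h ▸ hg)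
          have h₂ : γ ≠ d.σ g := fun h => (d.hout g hg).2.2 (h ▸ hγ)
          simp [h₁, h₂, Pi.single_apply]
    · rintro x y _ _ ⟨hx, hx'⟩ ⟨hy, hy'⟩
      exact ⟨fun j h₁ h₂ h₃ => by simp [hx j h₁ h₂ h₃, hy j h₁ h₂ h₃],
        fun γ hγ => by simp [hx' γ hγ, hy' γ hγ]⟩
    · rintro c x _ ⟨hx, hx'⟩
      exact ⟨fun j h₁ h₂ h₃ => by simp [hx j h₁ h₂ h₃], fun γ hγ => by simp [hx' γ hγ]⟩
  · rintro ⟨h₀, hσ⟩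
    have hv : v = ∑ b ∈ d.B, v b • (Pi.single b 1 : Fin n → K) +
        ∑ g ∈ d.C, v g • (Pi.single g 1 + Pi.single (d.σ g) 1 : Fin n → K) := by
      ext i
      have hswap (g : Fin n) : i = d.σ g ↔ d.σ i = g :=
        ⟨fun h => by rw [h, d.hinv], fun h => by rw [← h, d.hinv]⟩
      simp only [Pi.add_apply, Finset.sum_apply, Pi.smul_apply, Pi.single_apply, smul_eq_mul,
        mul_add, mul_ite, mul_one, mul_zero, Finset.sum_add_distrib, hswap, Finset.sum_ite_eq]
      by_cases hB : i ∈ d.B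
      · have hC : i ∉ d.C := Finset.disjoint_left.mp d.hdisj hB
        have hσC : d.σ i ∉ d.C := fun h => (d.hout _ h).2.1 (by rwa [d.hinv])
        simp [hB, hC, hσC]
      by_cases hC : i ∈ d.C
      · simp [hB, hC, (d.hout i hC).2.2]
      by_cases hσC : d.σ i ∈ d.C
      · simp [hB, hC, hσC, hσ _ hσC, d.hinv]
      · simpa [hB, hC, hσC] using
          h₀ i hB hC fun γ hγ h => hσC (by rwa [h, d.hinv])
    rw [hv]
    exact add_mem
      (Submodule.sum_mem _ fun b hb =>
        Submodule.smul_mem _ _ (Submodule.subset_span (Or.inl ⟨b, hb, rfl⟩)))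
      (Submodule.sum_mem _ fun g hg =>
        Submodule.smul_mem _ _ (Submodule.subset_span (Or.inr ⟨g, hg, rfl⟩)))

theorem Submodule.map_eq_self_iff_map_le_of_injective {K V : Type*} [Field K] [AddCommGroup V]
    [Module K V] [FiniteDimensional K V] {f : V →ₗ[K] V} (hf : Function.Injective f)
    (p : Submodule K V) : p.map f = p ↔ p.map f ≤ p :=
  ⟨fun h => h.le, fun h => Submodule.eq_of_le_of_finrank_eq h
    (Submodule.equivMapOfInjective f hf p).symm.finrank_eq⟩

theorem map_canonU_le_iff {K : Type*} [Field K] {n k l : ℕ} (d : CombData n k l)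
    (M : Matrix (Fin n) (Fin n) K) :
    (canonU K d).map M.mulVecLin ≤ canonU K d ↔ ∀ a ∈ d.A, ∀ i, i ∉ d.A → M i a = 0 := by
  rw [Submodule.map_le_iff_le_comap]
  conv_lhs => lhs; rw [canonU]
  rw [Submodule.span_le, Set.image_subset_iff]
  refine forall₂_congr fun a _ => ?_
  simp [mem_canonU_iff]

theorem map_canonW_le_iff {K : Type*} [Field K] {n k l : ℕ} (d : CombData n k l)
    (M : Matrix (Fin n) (Fin n) K) :
    (canonW K d).map M.mulVecLin ≤ canonW K d ↔
      (∀ b ∈ d.B,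
        (∀ j, j ∉ d.B → j ∉ d.C → (∀ γ ∈ d.C, j ≠ d.σ γ) → M j b = 0) ∧
          ∀ γ ∈ d.C, M γ b = M (d.σ γ) b) ∧
      (∀ γ ∈ d.C,
        (∀ j, j ∉ d.B → j ∉ d.C → (∀ γ' ∈ d.C, j ≠ d.σ γ') → M j γ + M j (d.σ γ) = 0) ∧
          ∀ γ' ∈ d.C, M γ' γ + M γ' (d.σ γ) = M (d.σ γ') γ + M (d.σ γ') (d.σ γ)) := by
  rw [Submodule.map_le_iff_le_comap]
  conv_lhs => lhs; rw [canonW]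
  rw [Submodule.span_le, Set.union_subset_iff, Set.image_subset_iff, Set.image_subset_iff]
  refine and_congr (forall₂_congr fun b _ => ?_) (forall₂_congr fun γ _ => ?_)
  · simp [mem_canonW_iff]
  · simp [mem_canonW_iff, Matrix.mulVec_add]

/-- Let `(U, W)` be the canonical configuration attached to combinatorial
data `(ᾱ, β̄, γ̄, σ)` of type `(n, k, l)`. An invertible upper-triangular matrix
`M = (a_{ij})` stabilizes both `U` and `W` if and only if the five listed systems of
linear equations on its entries hold. -/
theorem stabilizer_iff_equations (K : Type*) [Field K] (n k l : ℕ) (d : CombData n k l)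
    (M : Matrix (Fin n) (Fin n) K) (htri : M.BlockTriangular id) (hunit : IsUnit M.det) :
    (Submodule.map M.mulVecLin (canonU K d) = canonU K d ∧
        Submodule.map M.mulVecLin (canonW K d) = canonW K d) ↔
      ((∀ a ∈ d.A, ∀ i, i ∉ d.A → M i a = 0) ∧
        (∀ b ∈ d.B, ∀ j, j ∉ d.B → j ∉ d.C → (∀ γ ∈ d.C, j ≠ d.σ γ) → M j b = 0) ∧
        (∀ b ∈ d.B, ∀ γ ∈ d.C, M γ b = M (d.σ γ) b) ∧
        (∀ γ ∈ d.C, ∀ j, j ∉ d.B → j ∉ d.C → (∀ γ' ∈ d.C, j ≠ d.σ γ') →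
          M j γ + M j (d.σ γ) = 0) ∧
        (∀ γ ∈ d.C, ∀ γ' ∈ d.C,
          M γ' γ + M γ' (d.σ γ) = M (d.σ γ') γ + M (d.σ γ') (d.σ γ))) := by
  have hinj : Function.Injective M.mulVecLin :=
    Matrix.mulVec_injective_of_isUnit ((Matrix.isUnit_iff_isUnit_det M).mpr hunit)
  rw [Submodule.map_eq_self_iff_map_le_of_injective hinj,
    Submodule.map_eq_self_iff_map_le_of_injective hinj, map_canonU_le_iff, map_canonW_le_iff]
  simp only [forall_and, and_assoc]
end

section
/- Let (U, W) be the canonical configuration attached to combinatorial data (ᾱ, β̄, γ̄, σ) of type (n,k,l), and let r = #γ̄. An invertible diagonal matrix D = diag(d_1,…,d_n) satisfies D·U = U and D·W = W if and only if d_γ = d_{σ(γ)} for every γ ∈ γ̄. Consequently, the group T_{(U,W)} of all invertible diagonal matrices stabilizing both U and W is isomorphic, as a group, to (K^×)^{n−r}. -/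
/-- The group `T_{(U,W)}` of invertible diagonal matrices (encoded by their diagonals
`f : Fin n → Kˣ`) stabilizing both subspaces of the canonical configuration. -/
def diagStab (K : Type*) [Field K] {n k l : ℕ} (d : CombData n k l) :
    Subgroup (Fin n → Kˣ) where
  carrier := {f |
    Submodule.map (Matrix.diagonal fun i => (f i : K)).mulVecLin (canonU K d) = canonU K d ∧
    Submodule.map (Matrix.diagonal fun i => (f i : K)).mulVecLin (canonW K d) = canonW K d}
  one_mem' := by
    have h : (Matrix.diagonal fun i => ((1 : Fin n → Kˣ) i : K)) = (1 : Matrix (Fin n) (Fin n) K) := by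
      simp [Matrix.diagonal_one]
    simp [h, Matrix.mulVecLin_one, Submodule.map_id]
  mul_mem' := by
    intro f g hf hg
    have h : (Matrix.diagonal fun i => ((f * g) i : K)) =
        (Matrix.diagonal fun i => (f i : K)) * Matrix.diagonal fun i => (g i : K) := by
      rw [Matrix.diagonal_mul_diagonal]
      rfl
    constructor
    · rw [h, Matrix.mulVecLin_mul, Submodule.map_comp, hg.1, hf.1]
    · rw [h, Matrix.mulVecLin_mul, Submodule.map_comp, hg.2, hf.2]
  inv_mem' := by
    intro f hf
    have h : (Matrix.diagonal fun i => (f⁻¹ i : K)) * (Matrix.diagonal fun i => (f i : K)) =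
        (1 : Matrix (Fin n) (Fin n) K) := by
      rw [Matrix.diagonal_mul_diagonal, ← Matrix.diagonal_one]
      funext i j
      by_cases hij : i = j <;> simp [hij]
    constructor
    · conv_lhs => rw [← hf.1]
      rw [← Submodule.map_comp, ← Matrix.mulVecLin_mul, h, Matrix.mulVecLin_one,
        Submodule.map_id]
    · conv_lhs => rw [← hf.2]
      rw [← Submodule.map_comp, ← Matrix.mulVecLin_mul, h, Matrix.mulVecLin_one,
        Submodule.map_id]

/-- A linear map acting on each element of `S` by a nonzero scalar maps `span S` onto itself. -/
theorem Submodule.map_span_eq_of_smul {K V : Type*} [Field K] [AddCommGroup V] [Module K V]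
    (T : V →ₗ[K] V) (S : Set V) (h : ∀ x ∈ S, ∃ c : K, c ≠ 0 ∧ T x = c • x) :
    (Submodule.span K S).map T = Submodule.span K S := by
  apply le_antisymm
  · rw [Submodule.map_span, Submodule.span_le]
    rintro _ ⟨x, hx, rfl⟩
    obtain ⟨c, -, hT⟩ := h x hx
    rw [hT]
    exact Submodule.smul_mem _ _ (Submodule.subset_span hx)
  · rw [Submodule.span_le]
    intro x hx
    obtain ⟨c, hc, hT⟩ := h x hx
    refine ⟨c⁻¹ • x, Submodule.smul_mem _ _ (Submodule.subset_span hx), ?_⟩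
    rw [map_smul, hT, inv_smul_smul₀ hc]

theorem Matrix.diagonal_mulVecLin_single {K : Type*} [Field K] {n : ℕ} (f : Fin n → K)
    (i : Fin n) :
    (Matrix.diagonal f).mulVecLin (Pi.single i 1) = f i • (Pi.single i 1 : Fin n → K) := by
  ext j
  by_cases hj : j = i
  · subst hj
    simp [Matrix.mulVec_diagonal]
  · simp [Matrix.mulVec_diagonal, hj]

/-- Vectors of `W` have equal coordinates at `γ` and `σ γ`. -/
theorem apply_eq_of_mem_canonW {K : Type*} [Field K] {n k l : ℕ} (d : CombData n k l)
    {γ : Fin n} (hγ : γ ∈ d.C) {w : Fin n → K} (hw : w ∈ canonW K d) : w γ = w (d.σ γ) := by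
  have hle : canonW K d ≤
      LinearMap.ker (LinearMap.proj (R := K) (φ := fun _ : Fin n => K) γ -
        LinearMap.proj (d.σ γ)) := by
    refine Submodule.span_le.2 ?_
    rintro _ (⟨b, hb, rfl⟩ | ⟨g, hg, rfl⟩)
    · have hbC : γ ≠ b := fun e => Finset.disjoint_left.1 d.hdisj hb (e ▸ hγ)
      have hbσ : d.σ γ ≠ b := fun e => (d.hout γ hγ).2.1 (e ▸ hb)
      simp [hbC, hbσ]
    · have hgσ : γ ≠ d.σ g := fun e => (d.hout g hg).2.2 (e ▸ hγ)
      have hσg : d.σ γ ≠ g := fun e => (d.hout γ hγ).2.2 (e ▸ hg)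
      by_cases hgg : γ = g
      · subst hgg
        simp [hgσ, hσg]
      · simp [hgσ, hσg, hgg]
  simpa [sub_eq_zero] using hle hw

theorem diagonal_stabilizes_iff {K : Type*} [Field K] {n k l : ℕ} (d : CombData n k l)
    (f : Fin n → K) (hf : ∀ i, f i ≠ 0) :
    (Submodule.map (Matrix.diagonal f).mulVecLin (canonU K d) = canonU K d ∧
        Submodule.map (Matrix.diagonal f).mulVecLin (canonW K d) = canonW K d) ↔
      ∀ γ ∈ d.C, f γ = f (d.σ γ) := by
  constructor
  · rintro ⟨-, hW⟩ γ hγ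
    have hmem : (Pi.single γ 1 + Pi.single (d.σ γ) 1 : Fin n → K) ∈ canonW K d :=
      Submodule.subset_span (Or.inr ⟨γ, hγ, rfl⟩)
    have hD := apply_eq_of_mem_canonW d hγ (hW ▸ Submodule.mem_map_of_mem hmem)
    have hne : d.σ γ ≠ γ := (d.hlt γ hγ).ne
    rw [map_add, Matrix.diagonal_mulVecLin_single, Matrix.diagonal_mulVecLin_single] at hD
    simpa [hne, hne.symm] using hD
  · intro h
    constructor
    · apply Submodule.map_span_eq_of_smul
      rintro _ ⟨a, -, rfl⟩
      exact ⟨f a, hf a, Matrix.diagonal_mulVecLin_single f a⟩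
    · apply Submodule.map_span_eq_of_smul
      rintro _ (⟨b, -, rfl⟩ | ⟨g, hg, rfl⟩)
      · exact ⟨f b, hf b, Matrix.diagonal_mulVecLin_single f b⟩
      · refine ⟨f g, hf g, ?_⟩
        rw [map_add, Matrix.diagonal_mulVecLin_single, Matrix.diagonal_mulVecLin_single,
          ← h g hg, smul_add]

theorem mem_diagStab_iff {K : Type*} [Field K] {n k l : ℕ} (d : CombData n k l)
    (f : Fin n → Kˣ) : f ∈ diagStab K d ↔ ∀ γ ∈ d.C, f γ = f (d.σ γ) := by
  simp_rw [Units.ext_iff]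
  exact diagonal_stabilizes_iff d (fun i => (f i : K)) fun i => (f i).ne_zero

/-- An element of the diagonal stabilizer is determined by its entries outside `γ̄`, which are
arbitrary. -/
def diagStabEquiv (K : Type*) [Field K] {n k l : ℕ} (d : CombData n k l) :
    diagStab K d ≃* ({i // i ∉ d.C} → Kˣ) where
  toFun f i := f.1 i
  invFun g := ⟨fun i => if h : i ∈ d.C then g ⟨d.σ i, (d.hout i h).2.2⟩ else g ⟨i, h⟩, by
    rw [mem_diagStab_iff]
    intro γ hγ
    simp [hγ, (d.hout γ hγ).2.2]⟩
  left_inv f := by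
    ext i
    by_cases h : i ∈ d.C
    · simp [h, (mem_diagStab_iff d f.1).1 f.2 i h]
    · simp [h]
  right_inv g := by
    ext i
    simp [i.2]
  map_mul' _ _ := rfl

/-- An invertible diagonal matrix `D = diag (d_1, …, d_n)` stabilizes the
canonical configuration `(U, W)` iff `d_γ = d_{σ γ}` for every `γ ∈ γ̄`; consequently the
group `T_{(U,W)}` of invertible diagonal matrices stabilizing `U` and `W` is isomorphic to
`(Kˣ)^(n - r)`, where `r = #γ̄`. -/
theorem diagonal_stabilizer (K : Type*) [Field K] (n k l : ℕ) (d : CombData n k l) :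
    (∀ f : Fin n → K, (∀ i, f i ≠ 0) →
      ((Submodule.map (Matrix.diagonal f).mulVecLin (canonU K d) = canonU K d ∧
          Submodule.map (Matrix.diagonal f).mulVecLin (canonW K d) = canonW K d) ↔
        ∀ γ ∈ d.C, f γ = f (d.σ γ))) ∧
    Nonempty (diagStab K d ≃* (Fin (n - d.C.card) → Kˣ)) := by
  refine ⟨diagonal_stabilizes_iff d, ⟨(diagStabEquiv K d).trans ?_⟩⟩
  exact MulEquiv.arrowCongr (Fintype.equivFinOfCardEq (by simp)) (MulEquiv.refl Kˣ)
end

section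
/- Let (U, W) be the canonical configuration attached to combinatorial data (ᾱ, β̄, γ̄, σ) of type (n,k,l). Every invertible upper-triangular matrix A ∈ GL(n,K) with A·U = U and A·W = W factors uniquely as A = t·u, where t is an invertible diagonal matrix with t·U = U and t·W = W, and u is an upper-triangular matrix with all diagonal entries equal to 1 satisfying u·U = U and u·W = W. (That is, the stabilizer B_{(U,W)} of (U,W) in B is the semidirect product of its diagonal part T_{(U,W)} and its unitriangular part U_{(U,W)}.) -/
theorem Matrix.diagonal_mulVecLin_single_one {K ι : Type*} [CommRing K] [Fintype ι]
    [DecidableEq ι] (t : ι → K) (a : ι) :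
    (Matrix.diagonal t).mulVecLin (Pi.single a 1) = t a • Pi.single a (1 : K) := by
  ext i
  by_cases hi : i = a <;> simp [Matrix.mulVec_diagonal, hi]

namespace CombData

variable {K : Type*} [Field K] {n k l : ℕ} (d : CombData n k l)

theorem apply_eq_zero_of_mem_canonU {v : Fin n → K} (hv : v ∈ canonU K d) {i : Fin n}
    (hi : i ∉ d.A) : v i = 0 := by
  induction hv using Submodule.span_induction with
  | mem x hx =>
    obtain ⟨a, ha, rfl⟩ := hx
    exact Pi.single_eq_of_ne (by rintro rfl; exact hi ha) 1
  | zero => rfl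
  | add x y _ _ hx hy => simp [hx, hy]
  | smul c x _ hx => simp [hx]

theorem apply_eq_apply_of_mem_canonW {v : Fin n → K} (hv : v ∈ canonW K d) {g : Fin n}
    (hg : g ∈ d.C) : v g = v (d.σ g) := by
  obtain ⟨-, hgB, hgC⟩ := d.hout g hg
  induction hv using Submodule.span_induction with
  | mem x hx =>
    rcases hx with ⟨b, hb, rfl⟩ | ⟨c, hc, rfl⟩
    · have h₁ : g ≠ b := by
        rintro rfl
        exact Finset.disjoint_left.mp d.hdisj hb hg
      have h₂ : d.σ g ≠ b := by
        rintro rfl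
        exact hgB hb
      simp [h₁, h₂]
    · have h₁ : g ≠ d.σ c := by
        rintro rfl
        exact (d.hout c hc).2.2 hg
      have h₂ : d.σ g ≠ c := by
        rintro rfl
        exact hgC hc
      simp [Pi.single_apply, h₁, h₂]
  | zero => rfl
  | add x y _ _ hx hy => simp [hx, hy]
  | smul c x _ hx => simp [hx]

theorem map_diagonal_canonU_le (t : Fin n → K) :
    (canonU K d).map (Matrix.diagonal t).mulVecLin ≤ canonU K d := by
  rw [Submodule.map_le_iff_le_comap]
  refine Submodule.span_le.mpr ?_
  rintro _ ⟨a, ha, rfl⟩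
  rw [SetLike.mem_coe, Submodule.mem_comap, Matrix.diagonal_mulVecLin_single_one]
  exact Submodule.smul_mem _ _ (Submodule.subset_span ⟨a, ha, rfl⟩)

theorem map_diagonal_canonW_le (t : Fin n → K) (ht : ∀ g ∈ d.C, t g = t (d.σ g)) :
    (canonW K d).map (Matrix.diagonal t).mulVecLin ≤ canonW K d := by
  rw [Submodule.map_le_iff_le_comap]
  refine Submodule.span_le.mpr ?_
  rintro _ (⟨b, hb, rfl⟩ | ⟨g, hg, rfl⟩) <;> rw [SetLike.mem_coe, Submodule.mem_comap]
  · rw [Matrix.diagonal_mulVecLin_single_one]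
    exact Submodule.smul_mem _ _ (Submodule.subset_span (Or.inl ⟨b, hb, rfl⟩))
  · rw [map_add, Matrix.diagonal_mulVecLin_single_one, Matrix.diagonal_mulVecLin_single_one,
      ← ht g hg, ← smul_add]
    exact Submodule.smul_mem _ _ (Submodule.subset_span (Or.inr ⟨g, hg, rfl⟩))

/-- The diagonal entries at `γ` and `σ γ` of an upper-triangular matrix mapping `U` and `W` into
themselves agree. -/
theorem diag_eq_of_map_le {M : Matrix (Fin n) (Fin n) K} (htri : M.BlockTriangular id)
    (hU : (canonU K d).map M.mulVecLin ≤ canonU K d)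
    (hW : (canonW K d).map M.mulVecLin ≤ canonW K d) {g : Fin n} (hg : g ∈ d.C) :
    M g g = M (d.σ g) (d.σ g) := by
  have hlow : M g (d.σ g) = 0 := htri (d.hlt g hg)
  have hup : M (d.σ g) g = 0 := by
    have hmem := hU (Submodule.mem_map_of_mem
      (Submodule.subset_span ⟨g, d.hCA hg, rfl⟩ : Pi.single g (1 : K) ∈ canonU K d))
    simpa using d.apply_eq_zero_of_mem_canonU hmem (d.hout g hg).1
  have hmem := hW (Submodule.mem_map_of_mem
    (Submodule.subset_span (Or.inr ⟨g, hg, rfl⟩) :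
      Pi.single g (1 : K) + Pi.single (d.σ g) 1 ∈ canonW K d))
  simpa [Matrix.mulVec_add, hlow, hup] using d.apply_eq_apply_of_mem_canonW hmem hg

end CombData

theorem Matrix.map_mulVecLin_eq_of_inverse {K ι : Type*} [CommRing K] [Fintype ι]
    [DecidableEq ι] {S T : Matrix ι ι K} (hTS : T * S = 1) {V : Submodule K (ι → K)}
    (hT : V.map T.mulVecLin ≤ V) (hS : V.map S.mulVecLin ≤ V) : V.map T.mulVecLin = V := by
  refine le_antisymm hT ?_
  calc V = (V.map S.mulVecLin).map T.mulVecLin := by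
        rw [← Submodule.map_comp, ← Matrix.mulVecLin_mul, hTS, Matrix.mulVecLin_one,
          Submodule.map_id]
    _ ≤ V.map T.mulVecLin := Submodule.map_mono hS

/-- Every invertible upper-triangular matrix stabilizing the canonical
configuration `(U, W)` factors uniquely as a product `t * u` of an invertible diagonal
matrix `t` stabilizing `(U, W)` and a unitriangular matrix `u` stabilizing `(U, W)`:
the stabilizer `B_{(U,W)}` is the semidirect product of its toric and unipotent parts. -/
theorem stabilizer_semidirect_factorization (K : Type*) [Field K] (n k l : ℕ)
    (d : CombData n k l) (M : Matrix (Fin n) (Fin n) K)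
    (htri : M.BlockTriangular id) (hunit : IsUnit M.det)
    (hU : Submodule.map M.mulVecLin (canonU K d) = canonU K d)
    (hW : Submodule.map M.mulVecLin (canonW K d) = canonW K d) :
    ∃! p : Matrix (Fin n) (Fin n) K × Matrix (Fin n) (Fin n) K,
      p.1.IsDiag ∧ IsUnit p.1.det ∧
      Submodule.map p.1.mulVecLin (canonU K d) = canonU K d ∧
      Submodule.map p.1.mulVecLin (canonW K d) = canonW K d ∧
      p.2.BlockTriangular id ∧ (∀ i, p.2 i i = 1) ∧
      Submodule.map p.2.mulVecLin (canonU K d) = canonU K d ∧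
      Submodule.map p.2.mulVecLin (canonW K d) = canonW K d ∧
      M = p.1 * p.2 := by
  have hdiag : ∀ i, M i i ≠ 0 := by
    rw [Matrix.det_of_isUpperTriangular htri, isUnit_iff_ne_zero, Finset.prod_ne_zero_iff] at hunit
    exact fun i => hunit i (Finset.mem_univ i)
  set T : Matrix (Fin n) (Fin n) K := Matrix.diagonal fun i => M i i with hT
  set S : Matrix (Fin n) (Fin n) K := Matrix.diagonal fun i => (M i i)⁻¹ with hS
  have hTS : T * S = 1 := by simp [hT, hS, hdiag]
  have hST : S * T = 1 := by simp [hT, hS, hdiag]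
  have hσ : ∀ g ∈ d.C, M g g = M (d.σ g) (d.σ g) := fun g hg =>
    d.diag_eq_of_map_le htri hU.le hW.le hg
  have hσ' : ∀ g ∈ d.C, (M g g)⁻¹ = (M (d.σ g) (d.σ g))⁻¹ := fun g hg => by rw [hσ g hg]
  have hTU := d.map_diagonal_canonU_le fun i => M i i
  have hSU := d.map_diagonal_canonU_le fun i => (M i i)⁻¹
  have hTW := d.map_diagonal_canonW_le _ hσ
  have hSW := d.map_diagonal_canonW_le _ hσ'
  refine ⟨(T, S * M), ⟨Matrix.isDiag_diagonal _, ?_, Matrix.map_mulVecLin_eq_of_inverse hTS hTU hSU,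
    Matrix.map_mulVecLin_eq_of_inverse hTS hTW hSW, ?_, ?_, ?_, ?_, ?_⟩, ?_⟩
  · simp [hT, Matrix.det_diagonal, Finset.prod_ne_zero_iff, hdiag]
  · exact (Matrix.blockTriangular_diagonal _).mul htri
  · intro i
    simp [hS, hdiag]
  · rw [Matrix.mulVecLin_mul, Submodule.map_comp, hU]
    exact Matrix.map_mulVecLin_eq_of_inverse hST hSU hTU
  · rw [Matrix.mulVecLin_mul, Submodule.map_comp, hW]
    exact Matrix.map_mulVecLin_eq_of_inverse hST hSW hTW
  · rw [← mul_assoc, hTS, one_mul]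
  · rintro ⟨t, u⟩ ⟨ht, -, -, -, -, hu, -, -, hM⟩
    dsimp only at ht hu hM
    have htT : t = T := by
      obtain ⟨e, rfl⟩ : ∃ e, t = Matrix.diagonal e := ⟨_, ht.diagonal_diag.symm⟩
      have he : ∀ i, M i i = e i := fun i => by rw [hM, Matrix.diagonal_mul, hu, mul_one]
      rw [hT, funext he]
    rw [htT] at hM ⊢
    rw [hM, ← mul_assoc, hST, one_mul]
end

section
/- Let (ᾱ, β̄, γ̄, σ) be combinatorial data of type (n,k,l). The K-linear subspace of the space of all upper-triangular n×n matrices over K consisting of the matrices A = (a_{ij}) (with a_{ij} = 0 for i > j) that satisfy the stabilizer equations (1) a_{iα} = 0 for all α ∈ ᾱ, i ∉ ᾱ; (2) a_{jβ} = 0 for all β ∈ β̄, j ∉ β̄ ∪ γ̄ ∪ σ(γ̄); (3) a_{γβ} = a_{σ(γ)β} for all β ∈ β̄, γ ∈ γ̄; (4) a_{jγ} + a_{jσ(γ)} = 0 for all γ ∈ γ̄, j ∉ β̄ ∪ γ̄ ∪ σ(γ̄); (5) a_{γ′γ} + a_{γ′σ(γ)} = a_{σ(γ′)γ} + a_{σ(γ′)σ(γ)}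 for all γ, γ′ ∈ γ̄; has codimension #Y_1 + #Y_2 − #Y_com + #H in the n(n+1)/2-dimensional space of upper-triangular matrices. In other words, the stabilizer equations form a linear system of rank exactly #Y_1 + #Y_2 − #Y_com + #H. -/
namespace CombData

variable {n k l : ℕ}

/-- The boxes of the first Young diagram. -/
def Y1 (d : CombData n k l) : Finset (Fin n × Fin n) :=
  Finset.univ.filter fun p => p.1 < p.2 ∧ p.1 ∉ d.A ∧ p.2 ∈ d.A

/-- The boxes of the second Young diagram. -/
def Y2 (d : CombData n k l) : Finset (Fin n × Fin n) :=
  Finset.univ.filter fun p => p.1 < p.2 ∧ p.1 ∉ d.B ∪ d.C ∧ p.2 ∈ d.B ∪ d.C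

/-- The boxes of the common diagram. -/
def Ycom (d : CombData n k l) : Finset (Fin n × Fin n) := d.Y1 ∩ d.Y2

/-- The boxes of the common diagram lying in an inward hook of a dotted box
`(σ γ, γ)`, `γ ∈ γ̄`. -/
def H (d : CombData n k l) : Finset (Fin n × Fin n) :=
  d.Ycom.filter fun p => ∃ γ ∈ d.C, (p.1 = d.σ γ ∧ γ ≤ p.2) ∨ (p.2 = γ ∧ p.1 ≤ d.σ γ)

/-- The subspace of the space of upper-triangular `n × n` matrices cut out by
the stabilizer equations (1)–(5). -/
def solSpace (K : Type*) [Field K] (d : CombData n k l) :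
    Submodule K (Matrix (Fin n) (Fin n) K) where
  carrier := {M |
    (∀ i j : Fin n, j < i → M i j = 0) ∧
    (∀ a ∈ d.A, ∀ i, i ∉ d.A → M i a = 0) ∧
    (∀ b ∈ d.B, ∀ j, j ∉ d.B → j ∉ d.C → (∀ γ ∈ d.C, j ≠ d.σ γ) → M j b = 0) ∧
    (∀ b ∈ d.B, ∀ γ ∈ d.C, M γ b = M (d.σ γ) b) ∧
    (∀ γ ∈ d.C, ∀ j, j ∉ d.B → j ∉ d.C → (∀ γ' ∈ d.C, j ≠ d.σ γ') →
      M j γ + M j (d.σ γ) = 0) ∧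
    (∀ γ ∈ d.C, ∀ γ' ∈ d.C,
      M γ' γ + M γ' (d.σ γ) = M (d.σ γ') γ + M (d.σ γ') (d.σ γ))}
  zero_mem' := by
    refine ⟨?_, ?_, ?_, ?_, ?_, ?_⟩ <;> intros <;> simp
  add_mem' := by
    rintro M N ⟨h1, h2, h3, h4, h5, h6⟩ ⟨g1, g2, g3, g4, g5, g6⟩
    refine ⟨?_, ?_, ?_, ?_, ?_, ?_⟩
    · intro i j hij
      simp [Matrix.add_apply, h1 i j hij, g1 i j hij]
    · intro a ha i hi
      simp [Matrix.add_apply, h2 a ha i hi, g2 a ha i hi]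
    · intro b hb j hj1 hj2 hj3
      simp [Matrix.add_apply, h3 b hb j hj1 hj2 hj3, g3 b hb j hj1 hj2 hj3]
    · intro b hb γ hγ
      simp [Matrix.add_apply, h4 b hb γ hγ, g4 b hb γ hγ]
    · intro γ hγ j hj1 hj2 hj3
      have hM := h5 γ hγ j hj1 hj2 hj3
      have hN := g5 γ hγ j hj1 hj2 hj3
      simp only [Matrix.add_apply]
      linear_combination hM + hN
    · intro γ hγ γ' hγ'
      have hM := h6 γ hγ γ' hγ'
      have hN := g6 γ hγ γ' hγ'
      simp only [Matrix.add_apply]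
      linear_combination hM + hN
  smul_mem' := by
    rintro c M ⟨h1, h2, h3, h4, h5, h6⟩
    refine ⟨?_, ?_, ?_, ?_, ?_, ?_⟩
    · intro i j hij
      simp [Matrix.smul_apply, h1 i j hij]
    · intro a ha i hi
      simp [Matrix.smul_apply, h2 a ha i hi]
    · intro b hb j hj1 hj2 hj3
      simp [Matrix.smul_apply, h3 b hb j hj1 hj2 hj3]
    · intro b hb γ hγ
      simp [Matrix.smul_apply, h4 b hb γ hγ]
    · intro γ hγ j hj1 hj2 hj3
      have := h5 γ hγ j hj1 hj2 hj3
      simp only [Matrix.smul_apply, smul_eq_mul]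
      rw [← mul_add, this, mul_zero]
    · intro γ hγ γ' hγ'
      have := h6 γ hγ γ' hγ'
      simp only [Matrix.smul_apply, smul_eq_mul]
      rw [← mul_add, ← mul_add, this]

end CombData

/-- A space of matrices on which the entries in `F` can be prescribed freely and determine
the matrix has dimension `#F`. -/
theorem Submodule.finrank_eq_card_of_free_coords {K ι : Type*} [Field K] [Fintype ι]
    (S : Submodule K (Matrix ι ι K)) (F : Finset (ι × ι))
    (hinj : ∀ M ∈ S, (∀ p ∈ F, M p.1 p.2 = 0) → M = 0)
    (hsurj : ∀ y : ι → ι → K, ∃ M ∈ S, ∀ p ∈ F, M p.1 p.2 = y p.1 p.2) :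
    Module.finrank K S = F.card := by
  classical
  let f : S →ₗ[K] (F → K) :=
    { toFun := fun M p => M.1 p.1.1 p.1.2
      map_add' := fun _ _ => rfl
      map_smul' := fun _ _ => rfl }
  have hf : Function.Bijective f := by
    constructor
    · rw [injective_iff_map_eq_zero]
      exact fun M hM => Subtype.ext (hinj M.1 M.2 fun p hp => congrFun hM ⟨p, hp⟩)
    · intro y
      obtain ⟨M, hM, h⟩ := hsurj fun i j => if hp : (i, j) ∈ F then y ⟨(i, j), hp⟩ else 0
      exact ⟨⟨M, hM⟩, funext fun p => (h p.1 p.2).trans (dif_pos p.2)⟩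
  rw [(LinearEquiv.ofBijective f hf).finrank_eq, Module.finrank_fintype_fun_eq_card,
    Fintype.card_coe]

theorem Fin.card_filter_fst_le_snd (n : ℕ) :
    (Finset.univ.filter fun p : Fin n × Fin n => p.1 ≤ p.2).card = n * (n + 1) / 2 := by
  have h : (Finset.univ.filter fun p : Fin n × Fin n => p.1 ≤ p.2).card =
      ∑ j : Fin n, ((j : ℕ) + 1) := by
    rw [Finset.card_filter, Fintype.sum_prod_type_right]
    refine Finset.sum_congr rfl fun j _ => ?_
    rw [← Finset.card_filter, ← Fin.card_Iic]
    congr 1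
    ext
    simp
  rw [h, Fin.sum_univ_eq_sum_range fun j => j + 1]
  have := Finset.sum_range_id (n + 1)
  rw [Finset.sum_range_succ'] at this
  simpa [mul_comm] using this

namespace CombData

variable {n k l : ℕ} (d : CombData n k l)

theorem mem_A_of_mem_C {i : Fin n} (hi : i ∈ d.C) : i ∈ d.A := d.hCA hi

theorem notMem_B_of_mem_C {i : Fin n} (hi : i ∈ d.C) : i ∉ d.B :=
  Finset.disjoint_right.mp d.hdisj hi

theorem out_of_sigma_mem {i : Fin n} (hi : d.σ i ∈ d.C) :
    i ∉ d.A ∧ i ∉ d.B ∧ i ∉ d.C ∧ i < d.σ i := by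
  have h := d.hout _ hi
  have h' := d.hlt _ hi
  rw [d.hinv] at h h'
  exact ⟨h.1, h.2.1, h.2.2, h'⟩

theorem forall_ne_sigma_iff {j : Fin n} : (∀ γ ∈ d.C, j ≠ d.σ γ) ↔ d.σ j ∉ d.C := by
  refine ⟨fun h hj => h _ hj (d.hinv j).symm, ?_⟩
  rintro h γ hγ rfl
  exact h (by rwa [d.hinv])

/-- The boxes, outside the two diagrams, of the pivots that account for the boxes of `H`. -/
def hookPivots : Finset (Fin n × Fin n) :=
  Finset.univ.filter fun p => p.1 ≤ p.2 ∧
    (p.1 ∈ d.C ∧ p.2 ∈ d.B ∧ p.2 ∈ d.A ∨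
      p.1 ∉ d.A ∧ p.1 ∉ d.B ∧ d.σ p.1 ∉ d.C ∧ d.σ p.2 ∈ d.C ∨
      p.1 ∈ d.C ∧ p.2 ∈ d.C ∨
      d.σ p.1 ∈ d.C ∧ d.σ p.2 ∈ d.C ∧ d.σ p.2 < d.σ p.1)

theorem mem_H_iff {i j : Fin n} : (i, j) ∈ d.H ↔
    i < j ∧ i ∉ d.A ∧ j ∈ d.A ∧ i ∉ d.B ∧ (j ∈ d.B ∨ j ∈ d.C) ∧
      (d.σ i ∈ d.C ∧ d.σ i ≤ j ∨ j ∈ d.C ∧ i ≤ d.σ j) := by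
  have hex : (∃ γ ∈ d.C, (i = d.σ γ ∧ γ ≤ j) ∨ (j = γ ∧ i ≤ d.σ γ)) ↔
      (d.σ i ∈ d.C ∧ d.σ i ≤ j ∨ j ∈ d.C ∧ i ≤ d.σ j) := by
    constructor
    · rintro ⟨γ, hγ, ⟨rfl, h⟩ | ⟨rfl, h⟩⟩
      · rw [d.hinv]; exact Or.inl ⟨hγ, h⟩
      · exact Or.inr ⟨hγ, h⟩
    · rintro (⟨h, h'⟩ | ⟨h, h'⟩)
      · exact ⟨_, h, Or.inl ⟨(d.hinv i).symm, h'⟩⟩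
      · exact ⟨_, h, Or.inr ⟨rfl, h'⟩⟩
  have hC := fun h => d.mem_A_of_mem_C (i := i) h
  simp only [H, Ycom, Y1, Y2, Finset.mem_filter, Finset.mem_inter, Finset.mem_univ, true_and,
    Finset.mem_union, hex]
  tauto

theorem card_hookPivots : d.hookPivots.card = d.H.card := by
  symm
  refine Finset.card_nbij'
    (fun p => if d.σ p.1 ∈ d.C ∧ d.σ p.1 ≤ p.2 then (d.σ p.1, p.2) else (p.1, d.σ p.2))
    (fun p => if p.1 ∈ d.C then (d.σ p.1, p.2) else (p.1, d.σ p.2)) ?_ ?_ ?_ ?_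
  · rintro ⟨i, j⟩ h
    have h := d.mem_H_iff.mp h
    simp only [hookPivots, Finset.coe_filter, Set.mem_ofPred_eq, Finset.mem_univ, true_and]
    have := d.hinv
    have := fun x h => d.out_of_sigma_mem (i := x) h
    have := fun x h => d.mem_A_of_mem_C (i := x) h
    have := fun x h => d.notMem_B_of_mem_C (i := x) h
    split_ifs <;> grind
  · rintro ⟨i, j⟩ h
    simp only [hookPivots, Finset.coe_filter, Set.mem_ofPred_eq, Finset.mem_univ, true_and] at h
    have := d.hinv
    have := fun x h => d.out_of_sigma_mem (i := x) h
    have := fun x h => d.mem_A_of_mem_C (i := x) h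
    have := fun x h => d.notMem_B_of_mem_C (i := x) h
    dsimp only
    split_ifs
    · exact d.mem_H_iff.mpr (by grind)
    · exact d.mem_H_iff.mpr (by grind)
  · rintro ⟨i, j⟩ h
    have h := d.mem_H_iff.mp h
    have := d.hinv
    have := fun x h => d.mem_A_of_mem_C (i := x) h
    grind
  · rintro ⟨i, j⟩ h
    simp only [hookPivots, Finset.coe_filter, Set.mem_ofPred_eq, Finset.mem_univ, true_and] at h
    have := d.hinv
    have := fun x h => d.out_of_sigma_mem (i := x) h
    have := fun x h => d.mem_A_of_mem_C (i := x) h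
    grind

/-- The boxes of the entries that parametrize the solutions of the stabilizer equations. -/
def freeBoxes : Finset (Fin n × Fin n) :=
  (Finset.univ.filter fun p => p.1 ≤ p.2) \ ((d.Y1 ∪ d.Y2) ∪ d.hookPivots)

theorem mem_freeBoxes {i j : Fin n} : (i, j) ∈ d.freeBoxes ↔
    i ≤ j ∧ ¬ (i ∉ d.A ∧ j ∈ d.A) ∧ ¬ (i ∉ d.B ∧ i ∉ d.C ∧ (j ∈ d.B ∨ j ∈ d.C)) ∧
      ¬ (i ∈ d.C ∧ j ∈ d.B ∧ j ∈ d.A) ∧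
      ¬ (i ∉ d.A ∧ i ∉ d.B ∧ d.σ i ∉ d.C ∧ d.σ j ∈ d.C) ∧
      ¬ (i ∈ d.C ∧ j ∈ d.C) ∧
      ¬ (d.σ i ∈ d.C ∧ d.σ j ∈ d.C ∧ d.σ j < d.σ i) := by
  simp only [freeBoxes, hookPivots, Y1, Y2, Finset.mem_sdiff, Finset.mem_filter, Finset.mem_union,
    Finset.mem_univ, true_and]
  grind

theorem card_freeBoxes :
    d.freeBoxes.card + d.Y1.card + d.Y2.card + d.H.card =
      n * (n + 1) / 2 + d.Ycom.card := by
  have hsub : (d.Y1 ∪ d.Y2) ∪ d.hookPivots ⊆ Finset.univ.filter fun p => p.1 ≤ p.2 := by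
    intro p
    simp only [hookPivots, Y1, Y2, Finset.mem_filter, Finset.mem_union, Finset.mem_univ, true_and]
    grind
  have hdis : Disjoint (d.Y1 ∪ d.Y2) d.hookPivots := by
    rw [Finset.disjoint_left]
    intro p
    simp only [hookPivots, Y1, Y2, Finset.mem_filter, Finset.mem_union, Finset.mem_univ, true_and]
    have := fun x h => d.out_of_sigma_mem (i := x) h
    have := fun x h => d.mem_A_of_mem_C (i := x) h
    grind
  have h1 := Finset.card_sdiff_add_card_eq_card hsub
  have h2 := Finset.card_union_add_card_inter d.Y1 d.Y2
  rw [Finset.card_union_of_disjoint hdis, Fin.card_filter_fst_le_snd, d.card_hookPivots] at h1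
  unfold freeBoxes Ycom
  omega

theorem mem_solSpace_iff {K : Type*} [Field K] {M : Matrix (Fin n) (Fin n) K} :
    M ∈ d.solSpace K ↔
      (∀ i j : Fin n, j < i → M i j = 0) ∧
      (∀ a ∈ d.A, ∀ i, i ∉ d.A → M i a = 0) ∧
      (∀ b ∈ d.B, ∀ j, j ∉ d.B → j ∉ d.C → d.σ j ∉ d.C → M j b = 0) ∧
      (∀ b ∈ d.B, ∀ γ ∈ d.C, M γ b = M (d.σ γ) b) ∧
      (∀ γ ∈ d.C, ∀ j, j ∉ d.B → j ∉ d.C → d.σ j ∉ d.C → M j γ + M j (d.σ γ) = 0) ∧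
      (∀ γ ∈ d.C, ∀ γ' ∈ d.C,
        M γ' γ + M γ' (d.σ γ) = M (d.σ γ') γ + M (d.σ γ') (d.σ γ)) := by
  simp only [← d.forall_ne_sigma_iff]
  rfl

theorem eq_zero_of_freeBoxes {K : Type*} [Field K] {M : Matrix (Fin n) (Fin n) K}
    (hM : M ∈ d.solSpace K) (h : ∀ p ∈ d.freeBoxes, M p.1 p.2 = 0) : M = 0 := by
  obtain ⟨h1, h2, h3, h4, h5, h6⟩ := d.mem_solSpace_iff.mp hM
  replace h := fun i j hij => h (i, j) (d.mem_freeBoxes.mpr hij)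
  have := d.hinv
  have hD := fun x h => d.out_of_sigma_mem (i := x) h
  have hA := fun x h => d.mem_A_of_mem_C (i := x) h
  have hB := fun x h => d.notMem_B_of_mem_C (i := x) h
  have hCnA : ∀ i j, i ∈ d.C → j ∉ d.A → M i j = 0 := by grind
  have hcolB : ∀ i j, j ∈ d.B → M i j = 0 := by grind
  have hcolD : ∀ i j, d.σ j ∈ d.C → M i j = 0 := by
    intro i j hj
    by_cases hi : d.σ i ∈ d.C
    · by_cases hij : d.σ j < d.σ i
      · have h := h6 _ hj _ hi
        simpa [d.hinv, h1 _ _ hij, hCnA _ _ hi (hD _ hj).1, h2 _ (hA _ hj) _ (hD _ hi).1,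
          eq_comm] using h
      · grind
    · by_cases i ∈ d.A <;> by_cases i ∈ d.B <;> by_cases i ∈ d.C <;> grind
  have hcolC : ∀ i j, j ∈ d.C → M i j = 0 := by
    intro i j hj
    by_cases hi : i ∈ d.C
    · have h := h6 _ hj _ hi
      have hi' := hA _ hi
      have hσi := (d.hout _ hi).1
      simpa [hcolD _ (d.σ j) (by rwa [d.hinv]), h2 _ (hA _ hj) _ hσi] using h
    · by_cases i ∈ d.A <;> by_cases i ∈ d.B <;> grind
  ext i j
  rw [Matrix.zero_apply]
  by_cases j ∈ d.B <;> by_cases j ∈ d.C <;> by_cases d.σ j ∈ d.C <;> grind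

theorem exists_mem_solSpace {K : Type*} [Field K] (y : Fin n → Fin n → K) :
    ∃ M ∈ d.solSpace K, ∀ p ∈ d.freeBoxes, M p.1 p.2 = y p.1 p.2 := by
  obtain ⟨z, hzy, hz⟩ : ∃ z : Fin n → Fin n → K,
      (∀ p ∈ d.freeBoxes, z p.1 p.2 = y p.1 p.2) ∧ ∀ i j, (i, j) ∉ d.freeBoxes → z i j = 0 :=
    ⟨fun i j => if (i, j) ∈ d.freeBoxes then y i j else 0, fun p hp => if_pos hp,
      fun i j hij => if_neg hij⟩
  simp only [mem_freeBoxes] at hz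
  have := d.hinv
  have hD := fun x h => d.out_of_sigma_mem (i := x) h
  have hA := fun x h => d.mem_A_of_mem_C (i := x) h
  have hB := fun x h => d.notMem_B_of_mem_C (i := x) h
  let M : Matrix (Fin n) (Fin n) K := fun i j => z i j +
    if j ∈ d.B then (if d.σ i ∈ d.C then z (d.σ i) j else 0)
    else if j ∈ d.C then
      (if i ∈ d.C then -z i (d.σ j) + z (d.σ i) (d.σ j)
        else if i ∉ d.B ∧ d.σ i ∉ d.C then -z i (d.σ j) else 0)
    else 0
  refine ⟨M, d.mem_solSpace_iff.mpr ⟨?_, ?_, ?_, ?_, ?_, ?_⟩, ?_⟩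
  iterate 6 grind
  · rintro ⟨i, j⟩ hp
    rw [← hzy _ hp]
    rw [mem_freeBoxes] at hp
    grind

end CombData

/-- The subspace of the `n(n+1)/2`-dimensional space of upper-triangular
matrices cut out by the stabilizer equations has codimension `#Y₁ + #Y₂ − #Y_com + #H`:
equivalently, `dim + #Y₁ + #Y₂ + #H = n(n+1)/2 + #Y_com`. -/
theorem solSpace_codim (K : Type*) [Field K] (n k l : ℕ) (d : CombData n k l) :
    Module.finrank K (d.solSpace K) + d.Y1.card + d.Y2.card + d.H.card =
      n * (n + 1) / 2 + d.Ycom.card := by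
  rw [Submodule.finrank_eq_card_of_free_coords (d.solSpace K) d.freeBoxes
    (fun _ hM h => d.eq_zero_of_freeBoxes hM h) d.exists_mem_solSpace]
  exact d.card_freeBoxes
end

section
/- Let (U, W) be the canonical configuration attached to combinatorial data (ᾱ, β̄, γ̄, σ) of type (n,k,l), and let V_m = span(e_1,…,e_m) for 0 ≤ m ≤ n (with V_0 = 0). Then for all integers 1 ≤ i ≤ j ≤ n, setting S = {1,…,i−1} ∪ (ᾱ ∩ {i,…,j}), one has dim( ((U ∩ V_j) + V_{i−1}) ∩ W ) = #{ r ∈ β̄ ∪ γ̄ : r ∈ S and σ(r) ∈ S }. -/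
/-- The flag subspace `V_m = span (e_1, …, e_m)` of `K^n` (with `V_0 = 0`); in `0`-based
indexing, the span of the `e_a` with `a + 1 ≤ m`. -/
def Vm (K : Type*) [Field K] (n m : ℕ) : Submodule K (Fin n → K) :=
  Submodule.span K ((fun a => (Pi.single a 1 : Fin n → K)) '' {a : Fin n | (a : ℕ) < m})

/-- Membership of a (`0`-based) index `r` in the set `S = {1,…,i−1} ∪ (ᾱ ∩ {i,…,j})`
(in `1`-based terms, `r + 1` plays the role of the `1`-based index). -/
def memS {n k l : ℕ} (d : CombData n k l) (i j : ℕ) (r : Fin n) : Prop :=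
  (r : ℕ) + 1 < i ∨ (r ∈ d.A ∧ i ≤ (r : ℕ) + 1 ∧ (r : ℕ) + 1 ≤ j)

/-- The span of the standard basis vectors indexed by `s` consists of the vectors supported
on `s`. -/
theorem mem_span_single_image_iff {K ι : Type*} [Field K] [Finite ι] [DecidableEq ι]
    {s : Set ι} {x : ι → K} :
    x ∈ Submodule.span K ((fun a => (Pi.single a 1 : ι → K)) '' s) ↔ ∀ r, x r ≠ 0 → r ∈ s := by
  have h : (fun a => (Pi.single a 1 : ι → K)) = Pi.basisFun K ι := by
    ext a; simp
  rw [h, Module.Basis.mem_span_image]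
  simp [Set.subset_def]

namespace CombData

variable {n k l : ℕ} (d : CombData n k l)

theorem σ_eq_self_of_mem_B {r : Fin n} (hr : r ∈ d.B) : d.σ r = r := by
  by_contra h
  rcases d.hsupp r h with hC | ⟨g, hg, rfl⟩
  · exact Finset.disjoint_left.1 d.hdisj hr hC
  · exact (d.hout g hg).2.1 hr

/-- The generator of the canonical `W` indexed by `r ∈ β̄ ∪ γ̄`: `e_r` if `r ∉ γ̄`, and
`e_r + e_{σ r}` if `r ∈ γ̄`. -/
def generator (K : Type*) [Field K] (r : Fin n) : Fin n → K :=
  if r ∈ d.C then Pi.single r 1 + Pi.single (d.σ r) 1 else Pi.single r 1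

theorem generator_apply (K : Type*) [Field K] {r s : Fin n} (hs : s ∈ d.B ∨ s ∈ d.C) :
    d.generator K r s = if r = s then 1 else 0 := by
  unfold generator
  split_ifs with hr h h
  · subst h
    simp [(d.hlt r hr).ne']
  · have : s ≠ d.σ r := by
      rintro rfl
      exact hs.elim (d.hout r hr).2.1 (d.hout r hr).2.2
    simp [this, Ne.symm h]
  · simp [h]
  · simp [Ne.symm h]

theorem generator_apply_σ (K : Type*) [Field K] {r s : Fin n} (hr : r ∈ d.B ∨ r ∈ d.C)
    (hs : s ∈ d.B ∨ s ∈ d.C) :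
    d.generator K r (d.σ s) = d.generator K r s := by
  rcases hs with hs | hs
  · rw [d.σ_eq_self_of_mem_B hs]
  rw [d.generator_apply K (.inr hs)]
  have hne : d.σ s ≠ r := by
    rintro rfl
    exact hr.elim (d.hout s hs).2.1 (d.hout s hs).2.2
  unfold generator
  split_ifs with hC h h
  · subst h
    simp [hne]
  · simp [hne, Ne.symm h]
  · exact absurd (h ▸ hs) hC
  · simp [hne]

theorem generator_apply_eq_zero (K : Type*) [Field K] {r t : Fin n} (h : t ≠ r)
    (hσ : t ≠ d.σ r) : d.generator K r t = 0 := by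
  unfold generator
  split_ifs <;> simp [h, hσ]

theorem canonW_eq_span_generator (K : Type*) [Field K] :
    canonW K d = Submodule.span K (d.generator K '' {r | r ∈ d.B ∨ r ∈ d.C}) := by
  have hB : (fun b => (Pi.single b 1 : Fin n → K)) '' ↑d.B = d.generator K '' ↑d.B :=
    Set.image_congr fun b hb => by
      simp [generator, Finset.disjoint_left.1 d.hdisj (Finset.mem_coe.1 hb)]
  have hC : (fun g => (Pi.single g 1 + Pi.single (d.σ g) 1 : Fin n → K)) '' ↑d.C =
      d.generator K '' ↑d.C :=
    Set.image_congr fun g hg => by simp [generator, Finset.mem_coe.1 hg]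
  rw [canonW, hB, hC, ← Set.image_union]
  rfl

theorem apply_σ_of_mem_canonW {K : Type*} [Field K] {x : Fin n → K} (hx : x ∈ canonW K d)
    {s : Fin n} (hs : s ∈ d.B ∨ s ∈ d.C) : x (d.σ s) = x s := by
  rw [canonW_eq_span_generator] at hx
  induction hx using Submodule.span_induction with
  | mem x hx =>
    obtain ⟨r, hr, rfl⟩ := hx
    exact d.generator_apply_σ K hr hs
  | zero => rfl
  | add x y _ _ hx hy => simp [hx, hy]
  | smul c x _ hx => simp [hx]

open Classical in
theorem eq_sum_generator_of_mem_canonW {K : Type*} [Field K] {x : Fin n → K}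
    (hx : x ∈ canonW K d) :
    x = ∑ r with r ∈ d.B ∨ r ∈ d.C, x r • d.generator K r := by
  rw [canonW_eq_span_generator] at hx
  induction hx using Submodule.span_induction with
  | mem x hx =>
    obtain ⟨r, hr, rfl⟩ := hx
    rw [Finset.sum_eq_single_of_mem r (by simpa using hr)]
    · simp [d.generator_apply K hr]
    · intro s hs hsr
      simp [d.generator_apply K (Finset.mem_filter.1 hs).2, Ne.symm hsr]
  | zero => simp
  | add x y _ _ hx hy =>
    simp only [Pi.add_apply, add_smul, Finset.sum_add_distrib]
    rw [← hx, ← hy]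
  | smul c x _ hx =>
    simp only [Pi.smul_apply, smul_eq_mul, mul_smul, ← Finset.smul_sum]
    rw [← hx]

theorem linearIndepOn_generator (K : Type*) [Field K] :
    LinearIndepOn K (d.generator K) {r | r ∈ d.B ∨ r ∈ d.C} := by
  rw [LinearIndepOn, Fintype.linearIndependent_iff]
  intro g hg s
  have h := congrFun hg s
  simpa [Finset.sum_apply, d.generator_apply K s.2, Subtype.coe_inj] using h

theorem mem_inf_sup_Vm_iff {K : Type*} [Field K] {i j : ℕ} {x : Fin n → K} :
    x ∈ (canonU K d ⊓ Vm K n j) ⊔ Vm K n (i - 1) ↔ ∀ r, x r ≠ 0 → memS d i j r := by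
  have h : canonU K d ⊓ Vm K n j = Submodule.span K ((fun a => (Pi.single a 1 : Fin n → K)) ''
      (↑d.A ∩ {a : Fin n | (a : ℕ) < j})) := by
    ext y
    simp only [canonU, Vm, Submodule.mem_inf, mem_span_single_image_iff,
      ← forall_and, Set.mem_inter_iff]
  rw [h, Vm, ← Submodule.span_union, ← Set.image_union, mem_span_single_image_iff]
  refine forall₂_congr fun r _ => ?_
  simp only [memS, Set.mem_union, Set.mem_inter_iff, Finset.mem_coe, Set.mem_ofPred_eq]
  by_cases hr : r ∈ d.A <;> simp only [hr, true_and, false_and, false_or, or_false] <;> omega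

theorem inf_canonW_eq_span_generator (K : Type*) [Field K] (i j : ℕ) :
    ((canonU K d ⊓ Vm K n j) ⊔ Vm K n (i - 1)) ⊓ canonW K d =
      Submodule.span K (d.generator K ''
        {r | (r ∈ d.B ∨ r ∈ d.C) ∧ memS d i j r ∧ memS d i j (d.σ r)}) := by
  apply le_antisymm
  · rintro x ⟨hS, hW⟩
    replace hS := (d.mem_inf_sup_Vm_iff).1 hS
    rw [d.eq_sum_generator_of_mem_canonW hW]
    refine Submodule.sum_mem _ fun r hr => ?_
    replace hr := (Finset.mem_filter.1 hr).2
    by_cases h0 : x r = 0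
    · simp [h0]
    · have hσ : x (d.σ r) ≠ 0 := by rwa [d.apply_σ_of_mem_canonW hW hr]
      exact Submodule.smul_mem _ _ (Submodule.subset_span ⟨r, ⟨hr, hS r h0, hS _ hσ⟩, rfl⟩)
  · rw [Submodule.span_le]
    rintro _ ⟨r, ⟨hr, hS, hσ⟩, rfl⟩
    refine ⟨(d.mem_inf_sup_Vm_iff).2 fun t ht => ?_, ?_⟩
    · by_contra ht'
      refine ht (d.generator_apply_eq_zero K ?_ ?_) <;> rintro rfl <;> contradiction
    · rw [SetLike.mem_coe, canonW_eq_span_generator]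
      exact Submodule.subset_span ⟨r, hr, rfl⟩

end CombData

/-- For the canonical configuration `(U, W)` attached to combinatorial data
of type `(n, k, l)` and all `1 ≤ i ≤ j ≤ n`, setting `S = {1,…,i−1} ∪ (ᾱ ∩ {i,…,j})`,
one has `dim (((U ∩ V_j) + V_{i−1}) ∩ W) = #{r ∈ β̄ ∪ γ̄ : r ∈ S and σ r ∈ S}`. -/
theorem dim_intersection_formula (K : Type*) [Field K] (n k l : ℕ) (d : CombData n k l)
    (i j : ℕ) (hi : 1 ≤ i) (hij : i ≤ j) (hj : j ≤ n) :
    Module.finrank K ↥((((canonU K d) ⊓ Vm K n j) ⊔ Vm K n (i - 1)) ⊓ canonW K d) =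
      Set.ncard {r : Fin n | (r ∈ d.B ∨ r ∈ d.C) ∧ memS d i j r ∧ memS d i j (d.σ r)} := by
  have hli : LinearIndepOn K (d.generator K)
      {r : Fin n | (r ∈ d.B ∨ r ∈ d.C) ∧ memS d i j r ∧ memS d i j (d.σ r)} :=
    (d.linearIndepOn_generator K).mono fun _ hr => hr.1
  rw [d.inf_canonW_eq_span_generator K i j, Set.image_eq_range, ← Nat.card_coe_set_eq,
    Module.finrank, rank_span hli]
  exact Nat.card_range_of_injective hli.injective
end

section
/- Assume K is algebraically closed. Let k, l, d, n be integers with max(0, k+l−n) ≤ d ≤ min(k,l), and let ᾱ, β̄ ⊆ {1,…,n} satisfy #ᾱ = k, #β̄ = l, ᾱ ∪ β̄ = {1,…,k+l−d}, and ᾱ ∩ β̄ = {1,…,d}. Put U = span{e_a : a ∈ ᾱ} and W = span{e_b : b ∈ β̄} in K^n. Then the B-orbit of the pair (U, W) under the diagonal action equals the product of the B-orbits of its members: B·(U,W) = (B·U) × (B·W); that is, for all b_1, b_2 ∈ B there exists b ∈ B with b·U = b_1·U and b·W = b_2·W. (The minimal B-orbits are direct products of Schubert cells.) -/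
/-- A vector vanishing outside `S` lies in the span of the standard basis vectors indexed by `S`. -/
theorem mem_span_single_of_eq_zero {K ι : Type*} [Field K] [Fintype ι] [DecidableEq ι]
    {S : Set ι} {v : ι → K} (hv : ∀ i ∉ S, v i = 0) :
    v ∈ Submodule.span K ((fun a => (Pi.single a 1 : ι → K)) '' S) := by
  rw [pi_eq_sum_univ' v]
  refine Submodule.sum_mem _ fun i _ => ?_
  by_cases hi : i ∈ S
  · exact Submodule.smul_mem _ _ (Submodule.subset_span ⟨i, hi, rfl⟩)
  · simp [hv i hi]

/-- If each column of `M` indexed by `S` either agrees with the column of `N`, or has an index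
all of whose predecessors lie in `S`, then `M` maps the coordinate subspace of `S` into its image
under `N`. -/
theorem map_span_single_le_of_blockTriangular {K ι : Type*} [Field K] [Fintype ι] [LinearOrder ι]
    {S : Set ι} {M N : Matrix ι ι K} (hM : M.BlockTriangular id)
    (hN : N.BlockTriangular id) (hNdet : IsUnit N.det)
    (h : ∀ j ∈ S, N.col j = M.col j ∨ ∀ i ≤ j, i ∈ S) :
    (Submodule.span K ((fun a => (Pi.single a 1 : ι → K)) '' S)).map M.mulVecLin ≤
      (Submodule.span K ((fun a => (Pi.single a 1 : ι → K)) '' S)).map N.mulVecLin := by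
  rw [Submodule.map_span, Submodule.span_le]
  rintro _ ⟨_, ⟨j, hj, rfl⟩, rfl⟩
  rcases h j hj with h | h
  · exact ⟨Pi.single j 1, Submodule.subset_span ⟨j, hj, rfl⟩, by simp [h]⟩
  · have := N.invertibleOfIsUnitDet hNdet
    have hP : (N⁻¹ * M).BlockTriangular id :=
      (Matrix.blockTriangular_inv_of_blockTriangular hN).mul hM
    refine ⟨(N⁻¹ * M).mulVec (Pi.single j 1), mem_span_single_of_eq_zero fun i hi => ?_, ?_⟩
    · have hji : j < i := lt_of_not_ge fun hij => hi (h i hij)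
      simpa using hP hji
    · simp only [Matrix.mulVecLin_apply, Matrix.mulVec_mulVec,
        Matrix.mul_nonsing_inv_cancel_left _ _ hNdet]

/-- The equality version of `map_span_single_le_of_blockTriangular`. -/
theorem map_span_single_eq_of_blockTriangular {K ι : Type*} [Field K] [Fintype ι] [LinearOrder ι]
    {S : Set ι} {M N : Matrix ι ι K} (hM : M.BlockTriangular id) (hMdet : IsUnit M.det)
    (hN : N.BlockTriangular id) (hNdet : IsUnit N.det)
    (h : ∀ j ∈ S, N.col j = M.col j ∨ ∀ i ≤ j, i ∈ S) :
    (Submodule.span K ((fun a => (Pi.single a 1 : ι → K)) '' S)).map M.mulVecLin =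
      (Submodule.span K ((fun a => (Pi.single a 1 : ι → K)) '' S)).map N.mulVecLin :=
  le_antisymm (map_span_single_le_of_blockTriangular hM hN hNdet h)
    (map_span_single_le_of_blockTriangular hN hM hMdet fun j hj => (h j hj).imp_left Eq.symm)


/-- Over an algebraically closed field `K`, for a minimal-orbit
configuration `U = span {e_a : a ∈ ᾱ}`, `W = span {e_b : b ∈ β̄}` (where
`ᾱ ∪ β̄ = {1,…,k+l−d}` and `ᾱ ∩ β̄ = {1,…,d}`, encoded `0`-based in `Fin n`), the
`B`-orbit of `(U, W)` under the diagonal action of the group `B` of invertible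
upper-triangular matrices is the product of the `B`-orbits of `U` and `W`: for all
`b₁, b₂ ∈ B` there is `b ∈ B` with `b·U = b₁·U` and `b·W = b₂·W`. -/
theorem minimal_orbit_is_product (K : Type*) [Field K] [IsAlgClosed K]
    (n k l d : ℕ) (hd1 : k + l - n ≤ d) (hd2 : d ≤ k) (hd3 : d ≤ l)
    (A B : Finset (Fin n)) (hA : A.card = k) (hB : B.card = l)
    (hUnion : A ∪ B = Finset.univ.filter fun r : Fin n => (r : ℕ) < k + l - d)
    (hInter : A ∩ B = Finset.univ.filter fun r : Fin n => (r : ℕ) < d)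
    (U W : Submodule K (Fin n → K))
    (hU : U = Submodule.span K ((fun a => (Pi.single a 1 : Fin n → K)) '' ↑A))
    (hW : W = Submodule.span K ((fun b => (Pi.single b 1 : Fin n → K)) '' ↑B)) :
    ∀ M₁ M₂ : Matrix (Fin n) (Fin n) K,
      M₁.BlockTriangular id → IsUnit M₁.det → M₂.BlockTriangular id → IsUnit M₂.det →
      ∃ M : Matrix (Fin n) (Fin n) K, M.BlockTriangular id ∧ IsUnit M.det ∧
        Submodule.map M.mulVecLin U = Submodule.map M₁.mulVecLin U ∧
        Submodule.map M.mulVecLin W = Submodule.map M₂.mulVecLin W := by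
  intro M₁ M₂ h₁ hdet₁ h₂ hdet₂
  let M : Matrix (Fin n) (Fin n) K := Matrix.of fun i j => if j ∈ A then M₁ i j else M₂ i j
  have hM : M.BlockTriangular id := by
    intro i j hij
    simp [M, h₁ hij, h₂ hij]
  have hMdet : IsUnit M.det := by
    rw [Matrix.det_of_isUpperTriangular h₁, isUnit_iff_ne_zero, Finset.prod_ne_zero_iff] at hdet₁
    rw [Matrix.det_of_isUpperTriangular h₂, isUnit_iff_ne_zero, Finset.prod_ne_zero_iff] at hdet₂
    rw [Matrix.det_of_isUpperTriangular hM, isUnit_iff_ne_zero, Finset.prod_ne_zero_iff]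
    intro i hi
    by_cases hiA : i ∈ A
    · simpa [M, hiA] using hdet₁ i hi
    · simpa [M, hiA] using hdet₂ i hi
  refine ⟨M, hM, hMdet, ?_, ?_⟩
  · rw [hU]
    refine map_span_single_eq_of_blockTriangular hM hMdet h₁ hdet₁ fun j hj => Or.inl ?_
    have hjA : j ∈ A := hj
    ext i
    simp [M, hjA]
  · rw [hW]
    refine map_span_single_eq_of_blockTriangular hM hMdet h₂ hdet₂ fun j hj => ?_
    by_cases hjA : j ∈ A
    · right
      have mem_inter (i : Fin n) : i ∈ A ∩ B ↔ (i : ℕ) < d := by simp [hInter]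
      have hjd := (mem_inter j).1 (Finset.mem_inter.2 ⟨hjA, hj⟩)
      exact fun i hij => (Finset.mem_inter.1 ((mem_inter i).2 (lt_of_le_of_lt hij hjd))).2
    · left
      ext i
      simp [M, hjA]
end

section
/- For every pair of subspaces U, W ⊆ K^n with dim U = k and dim W = l, there exists exactly one combinatorial data (ᾱ, β̄, γ̄, σ) of type (n,k,l) such that (U, W) lies in the B-orbit (under the diagonal action of B on pairs of subspaces) of the canonical configuration attached to that data. Consequently, the B-orbits on pairs of subspaces of dimensions (k,l) in K^n are in bijection with the combinatorial data of type (n,k,l). -/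
section FlagAndLeads

variable {K : Type*} [Field K] {n : ℕ}

/-- `x` has its last nonzero coordinate at `i`. -/
def LeadsAt (x : Fin n → K) (i : Fin n) : Prop :=
  x i ≠ 0 ∧ ∀ j, i < j → x j = 0

/-- The member `span {e_j : j < t}` of the standard flag. -/
def stdFlag (K : Type*) [Field K] (n t : ℕ) : Submodule K (Fin n → K) where
  carrier := {x | ∀ j : Fin n, t ≤ j → x j = 0}
  add_mem' hx hy j hj := by simp [hx j hj, hy j hj]
  zero_mem' _ _ := rfl
  smul_mem' c x hx j hj := by simp [hx j hj]

/-- The positions of the last nonzero coordinates of the vectors of `X`. -/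
def pivots (X : Submodule K (Fin n → K)) : Set (Fin n) :=
  {i | ∃ x ∈ X, LeadsAt x i}

theorem stdFlag_mono {s t : ℕ} (h : s ≤ t) : stdFlag K n s ≤ stdFlag K n t :=
  fun _ hx j hj => hx j (h.trans hj)

theorem LeadsAt.mem_stdFlag {x : Fin n → K} {i : Fin n} (h : LeadsAt x i) :
    x ∈ stdFlag K n (i + 1) := fun j hj => h.2 j (Fin.lt_def.2 hj)

theorem leadsAt_iff {x : Fin n → K} {i : Fin n} :
    LeadsAt x i ↔ x i ≠ 0 ∧ x ∈ stdFlag K n (i + 1) := Iff.rfl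

theorem leadsAt_single (i : Fin n) : LeadsAt (Pi.single i 1 : Fin n → K) i :=
  ⟨by simp, fun j hj => by simp [hj.ne']⟩

theorem mem_stdFlag_of_mem_succ {x : Fin n → K} {p : Fin n}
    (h : x ∈ stdFlag K n (p + 1)) (hp : x p = 0) : x ∈ stdFlag K n p := by
  intro j hj
  rcases hj.eq_or_lt with h' | h'
  · rwa [← Fin.ext h']
  · exact h j h'

theorem exists_leadsAt {x : Fin n → K} (hx : x ≠ 0) : ∃ i, LeadsAt x i := by
  classical
  obtain ⟨i₀, hi₀⟩ := Function.ne_iff.1 hx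
  obtain ⟨i, hi, hmax⟩ := (Finset.univ.filter fun i => x i ≠ 0).exists_max_image id
    ⟨i₀, by simpa using hi₀⟩
  refine ⟨i, by simpa using hi, fun j hj => ?_⟩
  by_contra hne
  exact absurd (hmax j (by simpa using hne)) (not_le.2 hj)

theorem inf_stdFlag_succ_eq_sup (X : Submodule K (Fin n → K)) {p : Fin n} {x : Fin n → K}
    (hx : x ∈ X) (hl : LeadsAt x p) :
    X ⊓ stdFlag K n (p + 1) = X ⊓ stdFlag K n p ⊔ K ∙ x := by
  apply le_antisymm
  · rintro y ⟨hy, hyV⟩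
    refine Submodule.mem_sup.2 ⟨y - (y p / x p) • x, ⟨X.sub_mem hy (X.smul_mem _ hx), ?_⟩,
      (y p / x p) • x, Submodule.smul_mem _ _ (Submodule.mem_span_singleton_self x), by simp⟩
    refine mem_stdFlag_of_mem_succ
      (Submodule.sub_mem _ hyV (Submodule.smul_mem _ _ hl.mem_stdFlag)) ?_
    simp [div_mul_cancel₀ _ hl.1]
  · refine sup_le (inf_le_inf_left _ (stdFlag_mono (Nat.le_succ _))) ?_
    rw [Submodule.span_singleton_le_iff_mem]
    exact ⟨hx, hl.mem_stdFlag⟩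

theorem inf_stdFlag_succ_eq (X : Submodule K (Fin n → K)) {p : Fin n}
    (h : ¬ ∃ x ∈ X, LeadsAt x p) :
    X ⊓ stdFlag K n (p + 1) = X ⊓ stdFlag K n p := by
  refine le_antisymm ?_ (inf_le_inf_left _ (stdFlag_mono (Nat.le_succ _)))
  rintro y ⟨hy, hyV⟩
  refine ⟨hy, mem_stdFlag_of_mem_succ hyV ?_⟩
  by_contra hne
  exact h ⟨y, hy, hne, hyV⟩

theorem stdFlag_le_span {f : Fin n → Fin n → K} (hf : ∀ i, LeadsAt (f i) i) (t : ℕ) :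
    stdFlag K n t ≤ Submodule.span K (f '' {i | (i : ℕ) < t}) := by
  induction t with
  | zero =>
    intro x hx
    have : x = 0 := funext fun j => hx j (Nat.zero_le _)
    simp [this]
  | succ t ih =>
    by_cases ht : t < n
    · have h := inf_stdFlag_succ_eq_sup ⊤ (p := ⟨t, ht⟩) (Submodule.mem_top) (hf ⟨t, ht⟩)
      simp only [top_inf_eq] at h
      rw [h]
      refine sup_le (ih.trans (Submodule.span_mono (Set.image_mono fun i hi => ?_))) ?_
      · exact Nat.lt_succ_of_lt hi
      · rw [Submodule.span_singleton_le_iff_mem]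
        exact Submodule.subset_span ⟨⟨t, ht⟩, Nat.lt_succ_self t, rfl⟩
    · intro x hx
      refine Submodule.span_mono (Set.image_mono fun i hi => ?_) (ih fun j hj => ?_)
      · exact Nat.lt_succ_of_lt hi
      · exact absurd j.2 (by omega)

theorem exists_leadsAt_of_mem_span {f : Fin n → Fin n → K} (hf : ∀ i, LeadsAt (f i) i)
    (S : Finset (Fin n)) {z : Fin n → K} (hz : z ∈ Submodule.span K (f '' (S : Set (Fin n))))
    (hz0 : z ≠ 0) : ∃ m ∈ S, LeadsAt z m := by
  induction S using Finset.induction_on_max generalizing z with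
  | empty => simp at hz; exact absurd hz hz0
  | insert a s hlt ih =>
    rw [Finset.coe_insert, Set.image_insert_eq, Submodule.mem_span_insert] at hz
    obtain ⟨c, y, hy, rfl⟩ := hz
    have hya : y ∈ stdFlag K n a := by
      refine Submodule.span_le.2 ?_ hy
      rintro _ ⟨i, hi, rfl⟩
      exact stdFlag_mono (Fin.lt_def.1 (hlt i hi)) (hf i).mem_stdFlag
    by_cases hc : c = 0
    · subst hc
      simp only [zero_smul, zero_add] at hz0 ⊢
      obtain ⟨m, hm, h⟩ := ih hy hz0
      exact ⟨m, Finset.mem_insert_of_mem hm, h⟩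
    · refine ⟨a, Finset.mem_insert_self _ _, leadsAt_iff.2 ⟨?_, ?_⟩⟩
      · simpa [hya a le_rfl, hc] using (hf a).1
      · exact Submodule.add_mem _ (Submodule.smul_mem _ _ (hf a).mem_stdFlag)
          (stdFlag_mono (Nat.le_succ _) hya)

end FlagAndLeads

section UpperTriangular

variable {K : Type*} [Field K] {n : ℕ} {M : Matrix (Fin n) (Fin n) K}

theorem LeadsAt.mulVec (hM : M.BlockTriangular id) (hdet : IsUnit M.det)
    {x : Fin n → K} {i : Fin n} (h : LeadsAt x i) : LeadsAt (M.mulVec x) i := by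
  have hdiag : M i i ≠ 0 := by
    rw [Matrix.det_of_isUpperTriangular hM] at hdet
    exact Finset.prod_ne_zero_iff.1 hdet.ne_zero i (Finset.mem_univ i)
  constructor
  · rw [Matrix.mulVec, dotProduct, Finset.sum_eq_single i]
    · exact mul_ne_zero hdiag h.1
    · intro j _ hj
      rcases lt_or_gt_of_ne hj with hj | hj
      · rw [hM (show id j < id i from hj), zero_mul]
      · rw [h.2 j hj, mul_zero]
    · simp
  · intro j hj
    rw [Matrix.mulVec, dotProduct]
    refine Finset.sum_eq_zero fun m _ => ?_
    rcases lt_or_ge m j with hm | hm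
    · rw [hM (show id m < id j from hm), zero_mul]
    · rw [h.2 m (hj.trans_le hm), mul_zero]

theorem LeadsAt.eq {x : Fin n → K} {i j : Fin n} (hi : LeadsAt x i) (hj : LeadsAt x j) :
    i = j := by
  rcases lt_trichotomy i j with h | h | h
  · exact absurd (hi.2 j h) hj.1
  · exact h
  · exact absurd (hj.2 i h) hi.1

theorem leadsAt_mulVec_iff (hM : M.BlockTriangular id) (hdet : IsUnit M.det)
    {x : Fin n → K} {i : Fin n} : LeadsAt (M.mulVec x) i ↔ LeadsAt x i := by
  refine ⟨fun h => ?_, fun h => h.mulVec hM hdet⟩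
  have hx : x ≠ 0 := by
    rintro rfl
    exact h.1 (by simp)
  obtain ⟨j, hj⟩ := exists_leadsAt hx
  rwa [h.eq (hj.mulVec hM hdet)]

theorem pivots_map (hM : M.BlockTriangular id) (hdet : IsUnit M.det)
    (X : Submodule K (Fin n → K)) : pivots (X.map M.mulVecLin) = pivots X := by
  ext i
  simp [pivots, leadsAt_mulVec_iff hM hdet]

theorem mem_stdFlag_iff_leadsAt {t : ℕ} {x : Fin n → K} :
    x ∈ stdFlag K n t ↔ ∀ i, LeadsAt x i → (i : ℕ) < t := by
  constructor
  · intro h i hi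
    by_contra hlt
    exact hi.1 (h i (not_lt.1 hlt))
  · intro h
    by_cases hx : x = 0
    · simp [hx]
    · obtain ⟨i, hi⟩ := exists_leadsAt hx
      exact stdFlag_mono (h i hi) hi.mem_stdFlag

theorem map_inf_stdFlag (hM : M.BlockTriangular id) (hdet : IsUnit M.det)
    (X : Submodule K (Fin n → K)) (t : ℕ) :
    (X ⊓ stdFlag K n t).map M.mulVecLin = X.map M.mulVecLin ⊓ stdFlag K n t := by
  ext y
  simp only [Submodule.mem_map, Submodule.mem_inf]
  have key (x : Fin n → K) : M.mulVecLin x ∈ stdFlag K n t ↔ x ∈ stdFlag K n t := by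
    simp [mem_stdFlag_iff_leadsAt, leadsAt_mulVec_iff hM hdet]
  constructor
  · rintro ⟨x, ⟨hx, hxt⟩, rfl⟩
    exact ⟨⟨x, hx, rfl⟩, (key x).2 hxt⟩
  · rintro ⟨⟨x, hx, rfl⟩, hxt⟩
    exact ⟨x, ⟨hx, (key x).1 hxt⟩, rfl⟩

end UpperTriangular

section Canonical

variable {K : Type*} [Field K] {n k l : ℕ} (d : CombData n k l)

theorem eq_zero_of_mem_canonU {x : Fin n → K} (hx : x ∈ canonU K d) {i : Fin n}
    (hi : i ∉ d.A) : x i = 0 := by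
  suffices canonU K d ≤ LinearMap.ker (LinearMap.proj (R := K) (φ := fun _ : Fin n => K) i) from
    this hx
  refine Submodule.span_le.2 ?_
  rintro _ ⟨a, ha, rfl⟩
  have : i ≠ a := by rintro rfl; exact hi ha
  simp [this]

theorem single_mem_canonU {i : Fin n} (hi : i ∈ d.A) :
    (Pi.single i 1 : Fin n → K) ∈ canonU K d :=
  Submodule.subset_span ⟨i, hi, rfl⟩

theorem single_mem_canonW {i : Fin n} (hi : i ∈ d.B) :
    (Pi.single i 1 : Fin n → K) ∈ canonW K d :=
  Submodule.subset_span (Or.inl ⟨i, hi, rfl⟩)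

theorem single_add_single_mem_canonW {i : Fin n} (hi : i ∈ d.C) :
    (Pi.single i 1 + Pi.single (d.σ i) 1 : Fin n → K) ∈ canonW K d :=
  Submodule.subset_span (Or.inr ⟨i, hi, rfl⟩)

theorem eq_zero_of_mem_canonW {x : Fin n → K} (hx : x ∈ canonW K d) {i : Fin n}
    (hB : i ∉ d.B) (hC : i ∉ d.C) (hσ : ∀ g ∈ d.C, d.σ g ≠ i) : x i = 0 := by
  suffices canonW K d ≤ LinearMap.ker (LinearMap.proj (R := K) (φ := fun _ : Fin n => K) i) from
    this hx
  refine Submodule.span_le.2 ?_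
  rintro _ (⟨b, hb, rfl⟩ | ⟨g, hg, rfl⟩)
  · have : i ≠ b := by rintro rfl; exact hB hb
    simp [this]
  · have h1 : i ≠ g := by rintro rfl; exact hC hg
    simp [h1, (hσ g hg).symm]

theorem apply_σ_of_mem_canonW {x : Fin n → K} (hx : x ∈ canonW K d) {i : Fin n}
    (hC : i ∈ d.C) : x (d.σ i) = x i := by
  suffices canonW K d ≤ LinearMap.ker
      (LinearMap.proj (R := K) (φ := fun _ : Fin n => K) (d.σ i) - LinearMap.proj i) from
    sub_eq_zero.1 (this hx)
  refine Submodule.span_le.2 ?_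
  rintro _ (⟨b, hb, rfl⟩ | ⟨g, hg, rfl⟩)
  · have h1 : d.σ i ≠ b := by rintro rfl; exact (d.hout i hC).2.1 hb
    have h2 : i ≠ b := by rintro rfl; exact Finset.disjoint_left.1 d.hdisj hb hC
    simp [h1, h2]
  · by_cases h : i = g
    · subst h
      simp [(d.hlt i hC).ne, (d.hlt i hC).ne']
    · have h1 : d.σ i ≠ g := by rintro rfl; exact (d.hout i hC).2.2 hg
      have h2 : i ≠ d.σ g := by rintro rfl; exact (d.hout g hg).2.2 hC
      simp [h, h1, h2]

theorem pivots_canonU : pivots (canonU K d) = d.A := by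
  ext i
  constructor
  · rintro ⟨x, hx, hi⟩
    by_contra h
    exact hi.1 (eq_zero_of_mem_canonU d hx h)
  · exact fun h => ⟨_, single_mem_canonU d h, leadsAt_single i⟩

theorem leadsAt_single_add_single {i : Fin n} (hi : i ∈ d.C) :
    LeadsAt (Pi.single i 1 + Pi.single (d.σ i) 1 : Fin n → K) i := by
  have hlt := d.hlt i hi
  refine ⟨by simp [hlt.ne'], fun j hj => ?_⟩
  simp [hj.ne', (hlt.trans hj).ne']

theorem pivots_canonW : pivots (canonW K d) = (d.B : Set (Fin n)) ∪ d.C := by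
  ext i
  constructor
  · rintro ⟨x, hx, hi⟩
    by_contra h
    simp only [Set.mem_union, Finset.mem_coe, not_or] at h
    refine hi.1 (eq_zero_of_mem_canonW d hx h.1 h.2 ?_)
    rintro g hg rfl
    exact hi.1 (by rw [apply_σ_of_mem_canonW d hx hg, hi.2 g (d.hlt g hg)])
  · rintro (h | h)
    · exact ⟨_, single_mem_canonW d h, leadsAt_single i⟩
    · exact ⟨_, single_add_single_mem_canonW d h, leadsAt_single_add_single d h⟩

theorem pivots_canonU_inf_canonW :
    pivots (canonU K d ⊓ canonW K d) = (d.A : Set (Fin n)) ∩ d.B := by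
  ext i
  constructor
  · rintro ⟨x, ⟨hxU, hxW⟩, hi⟩
    have hA : i ∈ d.A := by
      by_contra h
      exact hi.1 (eq_zero_of_mem_canonU d hxU h)
    refine ⟨hA, ?_⟩
    by_contra hB
    by_cases hC : i ∈ d.C
    · refine hi.1 ?_
      rw [← apply_σ_of_mem_canonW d hxW hC]
      exact eq_zero_of_mem_canonU d hxU (d.hout i hC).1
    · refine hi.1 (eq_zero_of_mem_canonW d hxW hB hC ?_)
      rintro g hg rfl
      exact (d.hout g hg).1 hA
  · exact fun h => ⟨_, ⟨single_mem_canonU d h.1, single_mem_canonW d h.2⟩, leadsAt_single i⟩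

theorem mem_pivots_canonU_sup {t : ℕ} {i : Fin n} :
    i ∈ pivots (canonU K d ⊔ canonW K d ⊓ stdFlag K n t) ↔
      i ∈ d.A ∨ (i ∈ d.B ∧ (i : ℕ) < t) ∨ ∃ g ∈ d.C, (g : ℕ) < t ∧ d.σ g = i := by
  constructor
  · rintro ⟨x, hx, hi⟩
    obtain ⟨u, hu, w, ⟨hw, hwt⟩, rfl⟩ := Submodule.mem_sup.1 hx
    by_contra! h
    obtain ⟨hA, hB, hC⟩ := h
    have hui : u i = 0 := eq_zero_of_mem_canonU d hu hA
    refine hi.1 ?_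
    rw [Pi.add_apply, hui, zero_add]
    by_cases hiB : i ∈ d.B
    · exact hwt i (hB hiB)
    by_cases hσ : ∃ g ∈ d.C, d.σ g = i
    · obtain ⟨g, hg, rfl⟩ := hσ
      rw [apply_σ_of_mem_canonW d hw hg]
      exact hwt g (not_lt.1 fun hlt => hC g hg hlt rfl)
    · push Not at hσ
      exact eq_zero_of_mem_canonW d hw hiB (fun h => hA (d.hCA h)) hσ
  · rintro (h | ⟨h, hlt⟩ | ⟨g, hg, hlt, rfl⟩)
    · exact ⟨_, Submodule.mem_sup_left (single_mem_canonU d h), leadsAt_single i⟩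
    · exact ⟨_, Submodule.mem_sup_right ⟨single_mem_canonW d h,
        stdFlag_mono hlt (leadsAt_single i).mem_stdFlag⟩, leadsAt_single i⟩
    · refine ⟨Pi.single (d.σ g) 1, ?_, leadsAt_single _⟩
      refine Submodule.mem_sup.2 ⟨-Pi.single g 1,
        Submodule.neg_mem _ (single_mem_canonU d (d.hCA hg)),
        Pi.single g 1 + Pi.single (d.σ g) 1, ⟨single_add_single_mem_canonW d hg, ?_⟩, by simp⟩
      exact stdFlag_mono hlt (leadsAt_single_add_single d hg).mem_stdFlag

theorem finrank_canonU : Module.finrank K (canonU K d) = k := by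
  have hli : LinearIndependent K (fun a : d.A => (Pi.single (a : Fin n) 1 : Fin n → K)) :=
    (Pi.linearIndependent_single_one (Fin n) K).comp _ Subtype.val_injective
  have h := finrank_span_eq_card hli
  rw [Fintype.card_coe, d.hA] at h
  rw [canonU, Set.image_eq_range]
  exact h

theorem finrank_canonW : Module.finrank K (canonW K d) = l := by
  let v : ↥(d.B ∪ d.C) → Fin n → K := fun i =>
    if (i : Fin n) ∈ d.B then Pi.single (i : Fin n) 1
    else Pi.single (i : Fin n) 1 + Pi.single (d.σ i) 1
  have hli : LinearIndependent K v := by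
    refine LinearIndependent.of_comp
      (LinearMap.funLeft K K (Subtype.val : ↥(d.B ∪ d.C) → Fin n)) ?_
    convert Pi.linearIndependent_single_one ↥(d.B ∪ d.C) K using 1
    funext i j
    obtain ⟨i, hi⟩ := i
    obtain ⟨j, hj⟩ := j
    by_cases hB : i ∈ d.B
    · simp [v, hB, LinearMap.funLeft_apply, Pi.single_apply]
    · have hC : i ∈ d.C := (Finset.mem_union.1 hi).resolve_left hB
      have hne : j ≠ d.σ i := by
        rintro rfl
        rcases Finset.mem_union.1 hj with h | h
        · exact (d.hout i hC).2.1 h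
        · exact (d.hout i hC).2.2 h
      simp [v, hB, LinearMap.funLeft_apply, Pi.single_apply, hne]
  have h := finrank_span_eq_card hli
  rw [Fintype.card_coe, Finset.card_union_of_disjoint d.hdisj, d.hBC] at h
  suffices hset : (fun b => (Pi.single b 1 : Fin n → K)) '' ↑d.B ∪
      (fun g => Pi.single g 1 + Pi.single (d.σ g) 1) '' ↑d.C = Set.range v by
    rw [canonW, hset]
    exact h
  ext x
  simp only [Set.mem_union, Set.mem_image, Set.mem_range, Subtype.exists]
  constructor
  · rintro (⟨b, hb, rfl⟩ | ⟨g, hg, rfl⟩)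
    · exact ⟨b, Finset.mem_union_left _ hb, if_pos hb⟩
    · exact ⟨g, Finset.mem_union_right _ hg, if_neg (Finset.disjoint_right.1 d.hdisj hg)⟩
  · rintro ⟨i, hi, rfl⟩
    by_cases hB : i ∈ d.B
    · exact Or.inl ⟨i, hB, (if_pos hB).symm⟩
    · exact Or.inr ⟨i, (Finset.mem_union.1 hi).resolve_left hB, (if_neg hB).symm⟩

end Canonical

section Uniqueness

variable {K : Type*} [Field K] {n k l : ℕ}

theorem CombData.eq_of_σ_eqOn {d d' : CombData n k l} (hA : d.A = d'.A) (hB : d.B = d'.B)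
    (hC : d.C = d'.C) (hσ : ∀ g ∈ d.C, d.σ g = d'.σ g) : d = d' := by
  have hperm : d.σ = d'.σ := by
    ext1 x
    by_cases hx : x ∈ d.C
    · exact hσ x hx
    by_cases hx' : ∃ g ∈ d.C, x = d.σ g
    · obtain ⟨g, hg, rfl⟩ := hx'
      rw [d.hinv, hσ g hg, d'.hinv]
    · have h1 : d.σ x = x := by
        by_contra h
        rcases d.hsupp x h with h | h
        exacts [hx h, hx' h]
      have h2 : d'.σ x = x := by
        by_contra h
        rcases d'.hsupp x h with h | ⟨g, hg, rfl⟩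
        · exact hx (hC ▸ h)
        · rw [← hC] at hg
          exact hx' ⟨g, hg, (hσ g hg).symm⟩
      rw [h1, h2]
  cases d
  cases d'
  simp only at hA hB hC hperm
  subst hA hB hC hperm
  rfl

/-- The combinatorial data is determined by pivot sets of subspaces built from `U`, `W` and
the standard flag. -/
theorem CombData.eq_of_pivots {d d' : CombData n k l}
    (hU : pivots (canonU K d) = pivots (canonU K d'))
    (hW : pivots (canonW K d) = pivots (canonW K d'))
    (hI : pivots (canonU K d ⊓ canonW K d) = pivots (canonU K d' ⊓ canonW K d'))
    (hS : ∀ t, pivots (canonU K d ⊔ canonW K d ⊓ stdFlag K n t) =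
      pivots (canonU K d' ⊔ canonW K d' ⊓ stdFlag K n t)) : d = d' := by
  simp only [pivots_canonU, pivots_canonW, pivots_canonU_inf_canonW, Set.ext_iff, Set.mem_union,
    Set.mem_inter_iff, Finset.mem_coe] at hU hW hI
  have hd : ∀ i, i ∈ d.B → i ∉ d.C := fun _ hi => Finset.disjoint_left.1 d.hdisj hi
  have hd' : ∀ i, i ∈ d'.B → i ∉ d'.C := fun _ hi => Finset.disjoint_left.1 d'.hdisj hi
  have hCA := fun i => @d.hCA i
  have hCA' := fun i => @d'.hCA i
  have hC : ∀ i, i ∈ d.C ↔ i ∈ d'.C := fun i => by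
    have := hU i; have := hW i; have := hI i; have := hd i; have := hd' i
    have := hCA i; have := hCA' i
    tauto
  have hB : ∀ i, i ∈ d.B ↔ i ∈ d'.B := fun i => by
    have := hW i; have := hd i; have := hd' i; have := hC i
    tauto
  refine CombData.eq_of_σ_eqOn (Finset.ext hU) (Finset.ext hB) (Finset.ext hC) fun g hg => ?_
  have h1 : d.σ g ∈ pivots (canonU K d' ⊔ canonW K d' ⊓ stdFlag K n (g + 1)) := by
    rw [← hS, mem_pivots_canonU_sup]
    exact Or.inr (Or.inr ⟨g, hg, Nat.lt_succ_self _, rfl⟩)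
  have h2 : d.σ g ∉ pivots (canonU K d' ⊔ canonW K d' ⊓ stdFlag K n g) := by
    rw [← hS, mem_pivots_canonU_sup]
    rintro (h | ⟨h, -⟩ | ⟨g', -, hlt, h⟩)
    · exact (d.hout g hg).1 h
    · exact (d.hout g hg).2.1 h
    · rw [d.σ.injective h] at hlt
      exact lt_irrefl _ hlt
  rw [mem_pivots_canonU_sup] at h1 h2
  rcases h1 with h | ⟨h, -⟩ | ⟨g', hg', hlt, h⟩
  · exact absurd (Or.inl h) h2
  · exact absurd ((hB _).2 h) (d.hout g hg).2.1
  · rcases (Nat.lt_succ_iff.1 hlt).eq_or_lt with he | hl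
    · rw [← h, Fin.ext he]
    · exact absurd (Or.inr (Or.inr ⟨g', hg', hl, h⟩)) h2

end Uniqueness

section Existence

variable {K : Type*} [Field K] {n : ℕ}

/-- `f` is a basis adapted to the flag, in which the parts of `U` and `W` inside the `t`-th flag
member are in the canonical position described by `d`. -/
structure IsNormalForm (U W : Submodule K (Fin n → K)) (t : ℕ) {k l : ℕ} (d : CombData n k l)
    (f : Fin n → Fin n → K) : Prop where
  leads : ∀ i, LeadsAt (f i) i
  lt_A : ∀ i ∈ d.A, (i : ℕ) < t
  lt_B : ∀ i ∈ d.B, (i : ℕ) < t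
  eq_U : U ⊓ stdFlag K n t = Submodule.span K (f '' d.A)
  eq_W : W ⊓ stdFlag K n t =
    Submodule.span K (f '' d.B ∪ (fun g => f g + f (d.σ g)) '' d.C)

namespace IsNormalForm

variable {U W : Submodule K (Fin n → K)} {p : Fin n} {k l : ℕ} {d : CombData n k l}
  {f : Fin n → Fin n → K}

theorem lt_C {t : ℕ} (h : IsNormalForm U W t d f) : ∀ i ∈ d.C, (i : ℕ) < t :=
  fun i hi => h.lt_A i (d.hCA hi)

theorem notMem_A (h : IsNormalForm U W p d f) : p ∉ d.A := fun hp => lt_irrefl _ (h.lt_A p hp)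

theorem notMem_B (h : IsNormalForm U W p d f) : p ∉ d.B := fun hp => lt_irrefl _ (h.lt_B p hp)

theorem notMem_C (h : IsNormalForm U W p d f) : p ∉ d.C := fun hp => lt_irrefl _ (h.lt_C p hp)

theorem σ_ne (h : IsNormalForm U W p d f) : ∀ g ∈ d.C, d.σ g ≠ p := by
  rintro g hg rfl
  exact absurd (d.hlt g hg) (not_lt.2 (h.lt_C g hg).le)

end IsNormalForm

theorem span_image_update {f : Fin n → Fin n → K} {S : Finset (Fin n)} {p : Fin n}
    (hp : p ∉ S) (x : Fin n → K) :
    Submodule.span K (Function.update f p x '' S) = Submodule.span K (f '' S) := by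
  congr 1
  exact Set.image_congr fun i hi => Function.update_of_ne (by rintro rfl; exact hp hi) _ _

theorem span_union_image_update {f : Fin n → Fin n → K} {S T : Finset (Fin n)}
    {τ : Fin n → Fin n} {p : Fin n} (hS : p ∉ S) (hT : p ∉ T) (hτ : ∀ g ∈ T, τ g ≠ p)
    (x : Fin n → K) :
    Submodule.span K (Function.update f p x '' S ∪
        (fun g => Function.update f p x g + Function.update f p x (τ g)) '' T) =
      Submodule.span K (f '' S ∪ (fun g => f g + f (τ g)) '' T) := by
  congr 2
  · exact Set.image_congr fun i hi => Function.update_of_ne (by rintro rfl; exact hS hi) _ _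
  · refine Set.image_congr fun i hi => ?_
    rw [Function.update_of_ne (by rintro rfl; exact hT hi),
      Function.update_of_ne (hτ i hi)]

theorem leadsAt_update {f : Fin n → Fin n → K} (hf : ∀ i, LeadsAt (f i) i) {p : Fin n}
    {x : Fin n → K} (hx : LeadsAt x p) (i : Fin n) : LeadsAt (Function.update f p x i) i := by
  by_cases h : i = p
  · subst h; simpa using hx
  · simpa [h] using hf i

/-- Adjoin the unpaired index `p` to `ᾱ`. -/
def CombData.insertA {k l : ℕ} (d : CombData n k l) (p : Fin n) (hA : p ∉ d.A)
    (hσ : ∀ g ∈ d.C, d.σ g ≠ p) : CombData n (k + 1) l :=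
  { d with
    A := insert p d.A
    hA := by rw [Finset.card_insert_of_notMem hA, d.hA]
    hCA := d.hCA.trans (Finset.subset_insert _ _)
    hout := fun g hg => ⟨by simp [hσ g hg, (d.hout g hg).1], (d.hout g hg).2⟩ }

/-- Adjoin the unpaired index `p` to `β̄`. -/
def CombData.insertB {k l : ℕ} (d : CombData n k l) (p : Fin n) (hB : p ∉ d.B)
    (hC : p ∉ d.C) (hσ : ∀ g ∈ d.C, d.σ g ≠ p) : CombData n k (l + 1) :=
  { d with
    B := insert p d.B
    hBC := by rw [Finset.card_insert_of_notMem hB, add_right_comm, d.hBC]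
    hdisj := Finset.disjoint_insert_left.2 ⟨hC, d.hdisj⟩
    hout := fun g hg => ⟨(d.hout g hg).1, by simp [hσ g hg, (d.hout g hg).2.1],
      (d.hout g hg).2.2⟩ }

theorem CombData.σ_eq_self {k l : ℕ} (d : CombData n k l) {x : Fin n} (hC : x ∉ d.C)
    (hσ : ∀ g ∈ d.C, d.σ g ≠ x) : d.σ x = x := by
  by_contra h
  rcases d.hsupp x h with h | ⟨g, hg, h⟩
  exacts [hC h, hσ g hg h.symm]

/-- Adjoin the index `p` to `ᾱ` and `γ̄`, paired with the free index `m < p`. -/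
def CombData.insertC {k l : ℕ} (d : CombData n k l) (p m : Fin n) (hmp : m < p)
    (hpA : p ∉ d.A) (hpB : p ∉ d.B) (hpσ : ∀ g ∈ d.C, d.σ g ≠ p)
    (hmA : m ∉ d.A) (hmB : m ∉ d.B) (hmσ : ∀ g ∈ d.C, d.σ g ≠ m) :
    CombData n (k + 1) (l + 1) :=
  have hpC : p ∉ d.C := fun h => hpA (d.hCA h)
  have hmC : m ∉ d.C := fun h => hmA (d.hCA h)
  have hp : d.σ p = p := d.σ_eq_self hpC hpσ
  have hm : d.σ m = m := d.σ_eq_self hmC hmσ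
  have hof : ∀ x, x ≠ p → x ≠ m → (Equiv.swap p m * d.σ) x = d.σ x := fun x hxp hxm =>
    Equiv.swap_apply_of_ne_of_ne (fun h => hxp (d.σ.injective (h.trans hp.symm)))
      (fun h => hxm (d.σ.injective (h.trans hm.symm)))
  have hofC : ∀ g ∈ d.C, (Equiv.swap p m * d.σ) g = d.σ g := fun g hg =>
    hof g (by rintro rfl; exact hpC hg) (by rintro rfl; exact hmC hg)
  have hσp : (Equiv.swap p m * d.σ) p = m := by simp [hp]
  have hσm : (Equiv.swap p m * d.σ) m = p := by simp [hm]
  { A := insert p d.A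
    B := d.B
    C := insert p d.C
    σ := Equiv.swap p m * d.σ
    hA := by rw [Finset.card_insert_of_notMem hpA, d.hA]
    hBC := by rw [Finset.card_insert_of_notMem hpC, ← add_assoc, d.hBC]
    hCA := Finset.insert_subset_insert _ d.hCA
    hdisj := Finset.disjoint_insert_right.2 ⟨hpB, d.hdisj⟩
    hinv := fun x => by
      by_cases hxp : x = p
      · subst hxp; rw [hσp, hσm]
      by_cases hxm : x = m
      · subst hxm; rw [hσm, hσp]
      rw [hof x hxp hxm, hof, d.hinv]
      · exact fun h => hxp (d.σ.injective (h.trans hp.symm))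
      · exact fun h => hxm (d.σ.injective (h.trans hm.symm))
    hsupp := fun x hx => by
      by_cases hxp : x = p
      · exact Or.inl (by simp [hxp])
      by_cases hxm : x = m
      · exact Or.inr ⟨p, by simp, by rw [hσp, hxm]⟩
      rw [hof x hxp hxm] at hx
      rcases d.hsupp x hx with h | ⟨g, hg, h⟩
      · exact Or.inl (Finset.mem_insert_of_mem h)
      · exact Or.inr ⟨g, Finset.mem_insert_of_mem hg, by rw [hofC g hg, h]⟩
    hlt := fun g hg => by
      rcases Finset.mem_insert.1 hg with rfl | hg
      · rwa [hσp]
      · rw [hofC g hg]; exact d.hlt g hg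
    hout := fun g hg => by
      rcases Finset.mem_insert.1 hg with rfl | hg
      · rw [hσp]; simp [hmA, hmB, hmC, hmp.ne]
      · rw [hofC g hg]
        simp [d.hout g hg, hpσ g hg] }

theorem CombData.insertC_σ_self {k l : ℕ} (d : CombData n k l) (p m : Fin n) (hmp : m < p)
    (hpA : p ∉ d.A) (hpB : p ∉ d.B) (hpσ : ∀ g ∈ d.C, d.σ g ≠ p)
    (hmA : m ∉ d.A) (hmB : m ∉ d.B) (hmσ : ∀ g ∈ d.C, d.σ g ≠ m) :
    (d.insertC p m hmp hpA hpB hpσ hmA hmB hmσ).σ p = m := by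
  simp [CombData.insertC, d.σ_eq_self (fun h => hpA (d.hCA h)) hpσ]

theorem CombData.insertC_σ_of_mem {k l : ℕ} (d : CombData n k l) (p m : Fin n) (hmp : m < p)
    (hpA : p ∉ d.A) (hpB : p ∉ d.B) (hpσ : ∀ g ∈ d.C, d.σ g ≠ p)
    (hmA : m ∉ d.A) (hmB : m ∉ d.B) (hmσ : ∀ g ∈ d.C, d.σ g ≠ m) {g : Fin n} (hg : g ∈ d.C) :
    (d.insertC p m hmp hpA hpB hpσ hmA hmB hmσ).σ g = d.σ g :=
  Equiv.swap_apply_of_ne_of_ne (hpσ g hg) (hmσ g hg)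

namespace IsNormalForm

variable {U W : Submodule K (Fin n → K)} {p : Fin n} {k l : ℕ} {d : CombData n k l}
  {f : Fin n → Fin n → K}

theorem span_image_insert (h : IsNormalForm U W p d f) {x : Fin n → K} (hx : x ∈ U)
    (hl : LeadsAt x p) :
    U ⊓ stdFlag K n (p + 1) =
      Submodule.span K (Function.update f p x '' ↑(insert p d.A)) := by
  rw [inf_stdFlag_succ_eq_sup U hx hl, h.eq_U, Finset.coe_insert, Set.image_insert_eq,
    Submodule.span_insert, span_image_update h.notMem_A, Function.update_self, sup_comm]

theorem span_union_image_eq (h : IsNormalForm U W p d f) (x : Fin n → K) :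
    W ⊓ stdFlag K n p = Submodule.span K (Function.update f p x '' d.B ∪
      (fun g => Function.update f p x g + Function.update f p x (d.σ g)) '' d.C) := by
  rw [h.eq_W, span_union_image_update h.notMem_B h.notMem_C h.σ_ne]

theorem span_union_image_insert (h : IsNormalForm U W p d f) {x : Fin n → K} (hx : x ∈ W)
    (hl : LeadsAt x p) :
    W ⊓ stdFlag K n (p + 1) = Submodule.span K (Function.update f p x '' ↑(insert p d.B) ∪
      (fun g => Function.update f p x g + Function.update f p x (d.σ g)) '' d.C) := by
  rw [inf_stdFlag_succ_eq_sup W hx hl, h.span_union_image_eq x, Finset.coe_insert,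
    Set.image_insert_eq, Set.insert_union, Submodule.span_insert, Function.update_self, sup_comm]

/-- Every vector of the flag member splits off its components in `U` and `W`, leaving a
combination of the basis vectors with free index. -/
theorem exists_add_add (h : IsNormalForm U W p d f) {z : Fin n → K}
    (hz : z ∈ stdFlag K n p) :
    ∃ a ∈ U ⊓ stdFlag K n p, ∃ b ∈ W ⊓ stdFlag K n p, ∃ c ∈ Submodule.span K
      (f '' ↑(Finset.univ.filter fun i : Fin n =>
        i < p ∧ i ∉ d.A ∧ i ∉ d.B ∧ ∀ g ∈ d.C, d.σ g ≠ i)), a + b + c = z := by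
  set F := Finset.univ.filter fun i : Fin n =>
    i < p ∧ i ∉ d.A ∧ i ∉ d.B ∧ ∀ g ∈ d.C, d.σ g ≠ i with hF
  suffices hle : stdFlag K n p ≤
      (U ⊓ stdFlag K n p ⊔ W ⊓ stdFlag K n p) ⊔ Submodule.span K (f '' F) by
    obtain ⟨y, hy, c, hc, rfl⟩ := Submodule.mem_sup.1 (hle hz)
    obtain ⟨a, ha, b, hb, rfl⟩ := Submodule.mem_sup.1 hy
    exact ⟨a, ha, b, hb, c, hc, rfl⟩
  refine (stdFlag_le_span h.leads p).trans (Submodule.span_le.2 ?_)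
  rintro _ ⟨i, hi, rfl⟩
  rw [h.eq_U, h.eq_W]
  by_cases hA : i ∈ d.A
  · exact Submodule.mem_sup_left (Submodule.mem_sup_left (Submodule.subset_span ⟨i, hA, rfl⟩))
  by_cases hB : i ∈ d.B
  · exact Submodule.mem_sup_left (Submodule.mem_sup_right
      (Submodule.subset_span (Or.inl ⟨i, hB, rfl⟩)))
  by_cases hσ : ∃ g ∈ d.C, d.σ g = i
  · obtain ⟨g, hg, rfl⟩ := hσ
    refine Submodule.mem_sup_left (Submodule.mem_sup.2 ⟨-f g,
      Submodule.neg_mem _ (Submodule.subset_span ⟨g, d.hCA hg, rfl⟩), f g + f (d.σ g),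
      Submodule.subset_span (Or.inr ⟨g, hg, rfl⟩), by simp⟩)
  · push Not at hσ
    exact Submodule.mem_sup_right (Submodule.subset_span
      ⟨i, by simpa [hF] using ⟨hi, hA, hB, hσ⟩, rfl⟩)

theorem exists_of_no_common_lead (h : IsNormalForm U W p d f) {u w : Fin n → K}
    (hu : u ∈ U) (hul : LeadsAt u p) (hw : w ∈ W) (hwl : LeadsAt w p)
    (hno : ¬ ∃ x ∈ U ⊓ W, LeadsAt x p) :
    ∃ (k' l' : ℕ) (d' : CombData n k' l') (f' : Fin n → Fin n → K),
      IsNormalForm U W (p + 1) d' f' := by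
  have hz : w - (w p / u p) • u ∈ stdFlag K n p := by
    refine mem_stdFlag_of_mem_succ
      (Submodule.sub_mem _ hwl.mem_stdFlag (Submodule.smul_mem _ _ hul.mem_stdFlag)) ?_
    simp [div_mul_cancel₀ _ hul.1]
  obtain ⟨a, ⟨haU, ha⟩, b, ⟨hbW, hb⟩, z, hzF, hsum⟩ := h.exists_add_add hz
  set u' := (w p / u p) • u + a with hu'
  have hu'U : u' ∈ U := U.add_mem (U.smul_mem _ hu) haU
  have hu'l : LeadsAt u' p := by
    refine leadsAt_iff.2 ⟨?_, Submodule.add_mem _ (Submodule.smul_mem _ _ hul.mem_stdFlag)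
      (stdFlag_mono (Nat.le_succ _) ha)⟩
    simpa [hu', ha p le_rfl, div_mul_cancel₀ _ hul.1] using hwl.1
  have hw' : u' + z = w - b := by
    rw [hu', eq_sub_iff_add_eq, ← sub_eq_zero]
    rw [← sub_eq_zero] at hsum
    rw [← hsum]; abel
  have hw'W : u' + z ∈ W := hw' ▸ W.sub_mem hw hbW
  have hw'l : LeadsAt (u' + z) p := by
    rw [hw']
    refine leadsAt_iff.2 ⟨?_, Submodule.sub_mem _ hwl.mem_stdFlag
      (stdFlag_mono (Nat.le_succ _) hb)⟩
    simpa [hb p le_rfl] using hwl.1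
  have hz0 : z ≠ 0 := by
    rintro rfl
    rw [add_zero] at hw'W
    exact hno ⟨u', ⟨hu'U, hw'W⟩, hu'l⟩
  obtain ⟨m, hm, hml⟩ := exists_leadsAt_of_mem_span h.leads _ hzF hz0
  simp only [Finset.mem_filter, Finset.mem_univ, true_and] at hm
  obtain ⟨hmp, hmA, hmB, hmσ⟩ := hm
  have hmC : m ∉ d.C := fun h => hmA (d.hCA h)
  have h' : IsNormalForm U W p d (Function.update f m z) :=
    { leads := leadsAt_update h.leads hml
      lt_A := h.lt_A
      lt_B := h.lt_B
      eq_U := by rw [h.eq_U, span_image_update hmA]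
      eq_W := by rw [h.eq_W, span_union_image_update hmB hmC hmσ] }
  refine ⟨k + 1, l + 1, d.insertC p m hmp h.notMem_A h.notMem_B h.σ_ne hmA hmB hmσ,
    Function.update (Function.update f m z) p u', leadsAt_update h'.leads hu'l, ?_, ?_,
    h'.span_image_insert hu'U hu'l, ?_⟩
  · intro i hi
    rcases Finset.mem_insert.1 hi with rfl | hi
    · exact Nat.lt_succ_self _
    · exact (h.lt_A i hi).trans (Nat.lt_succ_self _)
  · exact fun i hi => (h.lt_B i hi).trans (Nat.lt_succ_self _)
  · rw [inf_stdFlag_succ_eq_sup W hw'W hw'l, h'.span_union_image_eq u']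
    have hC : (d.insertC p m hmp h.notMem_A h.notMem_B h.σ_ne hmA hmB hmσ).C = insert p d.C := rfl
    have hB : (d.insertC p m hmp h.notMem_A h.notMem_B h.σ_ne hmA hmB hmσ).B = d.B := rfl
    rw [hC, hB, Finset.coe_insert, Set.image_insert_eq, Set.union_insert, Submodule.span_insert,
      CombData.insertC_σ_self, Function.update_self, Function.update_of_ne hmp.ne,
      Function.update_self, sup_comm]
    congr 3
    exact Set.image_congr fun g hg => by rw [CombData.insertC_σ_of_mem _ _ _ _ _ _ _ _ _ _ hg]

theorem exists_succ (h : IsNormalForm U W p d f) :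
    ∃ (k' l' : ℕ) (d' : CombData n k' l') (f' : Fin n → Fin n → K),
      IsNormalForm U W (p + 1) d' f' := by
  have lt_succ {S : Finset (Fin n)} (hS : ∀ i ∈ S, (i : ℕ) < p) :
      ∀ i ∈ S, (i : ℕ) < p + 1 := fun i hi => (hS i hi).trans (Nat.lt_succ_self _)
  have lt_insert {S : Finset (Fin n)} (hS : ∀ i ∈ S, (i : ℕ) < p) :
      ∀ i ∈ insert p S, (i : ℕ) < p + 1 := by
    intro i hi
    rcases Finset.mem_insert.1 hi with rfl | hi
    · exact Nat.lt_succ_self _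
    · exact lt_succ hS i hi
  by_cases hU : ∃ u ∈ U, LeadsAt u p <;> by_cases hW : ∃ w ∈ W, LeadsAt w p
  · by_cases hUW : ∃ x ∈ U ⊓ W, LeadsAt x p
    · obtain ⟨x, ⟨hxU, hxW⟩, hx⟩ := hUW
      exact ⟨_, _, (d.insertA p h.notMem_A h.σ_ne).insertB p h.notMem_B h.notMem_C h.σ_ne,
        Function.update f p x, leadsAt_update h.leads hx, lt_insert h.lt_A, lt_insert h.lt_B,
        h.span_image_insert hxU hx, h.span_union_image_insert hxW hx⟩
    · obtain ⟨u, hu, hul⟩ := hU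
      obtain ⟨w, hw, hwl⟩ := hW
      exact h.exists_of_no_common_lead hu hul hw hwl hUW
  · obtain ⟨u, hu, hul⟩ := hU
    exact ⟨_, _, d.insertA p h.notMem_A h.σ_ne, Function.update f p u,
      leadsAt_update h.leads hul, lt_insert h.lt_A, lt_succ h.lt_B, h.span_image_insert hu hul,
      (inf_stdFlag_succ_eq W hW).trans (h.span_union_image_eq u)⟩
  · obtain ⟨w, hw, hwl⟩ := hW
    refine ⟨_, _, d.insertB p h.notMem_B h.notMem_C h.σ_ne, Function.update f p w,
      leadsAt_update h.leads hwl, lt_succ h.lt_A, lt_insert h.lt_B, ?_,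
      h.span_union_image_insert hw hwl⟩
    rw [inf_stdFlag_succ_eq U hU, h.eq_U]
    exact (span_image_update h.notMem_A w).symm
  · exact ⟨_, _, d, f, h.leads, lt_succ h.lt_A, lt_succ h.lt_B,
      (inf_stdFlag_succ_eq U hU).trans h.eq_U, (inf_stdFlag_succ_eq W hW).trans h.eq_W⟩

end IsNormalForm

theorem exists_isNormalForm (U W : Submodule K (Fin n → K)) (t : ℕ) (ht : t ≤ n) :
    ∃ (k l : ℕ) (d : CombData n k l) (f : Fin n → Fin n → K), IsNormalForm U W t d f := by
  induction t with
  | zero =>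
    have h0 : stdFlag K n 0 = ⊥ :=
      eq_bot_iff.2 fun x hx => funext fun j => hx j (Nat.zero_le _)
    exact ⟨0, 0, ⟨∅, ∅, ∅, 1, rfl, rfl, by simp, by simp, by simp, by simp, by simp, by simp⟩,
      fun i => Pi.single i 1, leadsAt_single, by simp, by simp, by simp [h0], by simp [h0]⟩
  | succ t ih =>
    obtain ⟨k, l, d, f, h⟩ := ih (Nat.le_of_succ_le ht)
    exact IsNormalForm.exists_succ (p := ⟨t, ht⟩) h

theorem exists_canonical (U W : Submodule K (Fin n → K)) :
    ∃ (k l : ℕ) (d : CombData n k l) (M : Matrix (Fin n) (Fin n) K),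
      M.BlockTriangular id ∧ IsUnit M.det ∧
      Submodule.map M.mulVecLin (canonU K d) = U ∧
      Submodule.map M.mulVecLin (canonW K d) = W := by
  obtain ⟨k, l, d, f, h⟩ := exists_isNormalForm U W n le_rfl
  have htop : stdFlag K n n = ⊤ := eq_top_iff.2 fun x _ j hj => absurd j.2 (not_lt.2 hj)
  have hU := h.eq_U
  have hW := h.eq_W
  rw [htop, inf_top_eq] at hU hW
  let M : Matrix (Fin n) (Fin n) K := Matrix.of fun i j => f j i
  have hM : M.BlockTriangular id := fun i j hij => (h.leads j).2 i hij
  have hsingle (i : Fin n) : M.mulVec (Pi.single i 1) = f i := by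
    rw [Matrix.mulVec_single_one]
    rfl
  refine ⟨k, l, d, M, hM, ?_, ?_, ?_⟩
  · rw [Matrix.det_of_isUpperTriangular hM, isUnit_iff_ne_zero]
    exact Finset.prod_ne_zero_iff.2 fun i _ => (h.leads i).1
  · rw [hU, canonU, Submodule.map_span, ← Set.image_comp]
    simp [Function.comp_def, hsingle]
  · rw [hW, canonW, Submodule.map_span, Set.image_union, ← Set.image_comp, ← Set.image_comp]
    simp [Function.comp_def, hsingle, Matrix.mulVec_add]

end Existence

/-- Every pair of subspaces `U, W ⊆ K^n` with `dim U = k`, `dim W = l`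
lies in the `B`-orbit (for the diagonal action of the group `B` of invertible
upper-triangular matrices) of the canonical configuration of exactly one combinatorial
data of type `(n, k, l)`: the `B`-orbits on such pairs are in bijection with the
combinatorial data of type `(n, k, l)`. -/
theorem borbit_classification (K : Type*) [Field K] (n k l : ℕ)
    (U W : Submodule K (Fin n → K))
    (hU : Module.finrank K U = k) (hW : Module.finrank K W = l) :
    ∃! d : CombData n k l, ∃ M : Matrix (Fin n) (Fin n) K,
      M.BlockTriangular id ∧ IsUnit M.det ∧
      Submodule.map M.mulVecLin (canonU K d) = U ∧
      Submodule.map M.mulVecLin (canonW K d) = W := by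
  have hinj {M : Matrix (Fin n) (Fin n) K} (hdet : IsUnit M.det) :
      Function.Injective M.mulVecLin :=
    Matrix.mulVec_injective_iff_isUnit.2 ((Matrix.isUnit_iff_isUnit_det M).2 hdet)
  obtain ⟨k', l', d, M, hM, hdet, hMU, hMW⟩ := exists_canonical U W
  obtain rfl : k' = k := by
    rw [← hU, ← hMU, ← (Submodule.equivMapOfInjective _ (hinj hdet) _).finrank_eq, finrank_canonU]
  obtain rfl : l' = l := by
    rw [← hW, ← hMW, ← (Submodule.equivMapOfInjective _ (hinj hdet) _).finrank_eq, finrank_canonW]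
  refine ⟨d, ⟨M, hM, hdet, hMU, hMW⟩, ?_⟩
  rintro d' ⟨M', hM', hdet', hMU', hMW'⟩
  refine CombData.eq_of_pivots (K := K) ?_ ?_ ?_ fun t => ?_
  · rw [← pivots_map hM hdet (canonU K d),
      ← pivots_map hM' hdet' (canonU K d'), hMU, hMU']
  · rw [← pivots_map hM hdet (canonW K d),
      ← pivots_map hM' hdet' (canonW K d'), hMW, hMW']
  · rw [← pivots_map hM hdet (canonU K d ⊓ canonW K d),
      ← pivots_map hM' hdet' (canonU K d' ⊓ canonW K d'), Submodule.map_inf _ (hinj hdet),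
      Submodule.map_inf _ (hinj hdet'), hMU, hMU', hMW, hMW']
  · rw [← pivots_map hM hdet (canonU K d ⊔ canonW K d ⊓ stdFlag K n t),
      ← pivots_map hM' hdet' (canonU K d' ⊔ canonW K d' ⊓ stdFlag K n t),
      Submodule.map_sup, Submodule.map_sup,
      map_inf_stdFlag hM hdet, map_inf_stdFlag hM' hdet', hMU, hMU', hMW, hMW']
end
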